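/- There exists a universal constant c > 0 such that for all integers v ≥ 1, 1 ≤ t ≤ v and t ≤ k ≤ v there exists a simple t-(v,k,λ) design (for some positive integer λ) whose size is at most (c·v/t)^(c·t). -/

import Mathlib

/-- A simple `t-(v,k,λ)` design is a family of distinct `k`-element subsets of `[v]`
such that every `t`-element subset of `[v]` is contained in exactly `λ` members. -/
def IsDesign (v k t lam : ℕ) (T : Finset (Finset (Fin v))) : Prop :=
  (∀ b ∈ T, b.card = k) ∧
    ∀ s : Finset (Fin v), s.card = t → (T.filter fun b => s ⊆ b).card = lam

section Davenport

open Finset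

/-- Greedy choice of roots of unity: few characters avoid all the chosen values. -/
lemma exists_roots_killing_characters {α G : Type*} [DecidableEq α] [AddCommGroup G] [Fintype G]
    (m : ℕ) (hm : 0 < m) (hexp : ∀ g : G, m • g = 0) (f : α → G) (X : Finset α) :
    ∃ z : α → ℂ, (∀ a, z a ≠ 0) ∧
      #{ψ : AddChar G ℂ | ∀ a ∈ X, ψ (f a) ≠ z a} * m ^ #X ≤ Fintype.card G * (m - 1) ^ #X := by
  classical
  induction X using Finset.induction_on with
  | empty =>
    refine ⟨fun _ => 1, fun _ => one_ne_zero, ?_⟩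
    simp [Finset.card_univ]
  | insert a X ha ih =>
    obtain ⟨z, hz, hcard⟩ := ih
    set C : Finset (AddChar G ℂ) := {ψ : AddChar G ℂ | ∀ a ∈ X, ψ (f a) ≠ z a} with hC
    set R : Finset ℂ := Polynomial.nthRootsFinset m (1 : ℂ) with hR
    have hRcard : #R = m := (Complex.isPrimitiveRoot_exp m hm.ne').card_nthRootsFinset
    have hmaps : ∀ ψ ∈ C, ψ (f a) ∈ R := by
      intro ψ _
      rw [hR, Polynomial.mem_nthRootsFinset hm, ← AddChar.map_nsmul_eq_pow, hexp,
        AddChar.map_zero_eq_one]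
    obtain ⟨y, hy, hle⟩ : ∃ y ∈ R, #C ≤ m * #{ψ ∈ C | ψ (f a) = y} := by
      by_contra! hcon
      have h1 := Finset.card_eq_sum_card_fiberwise hmaps
      have h2 : m * #C < m * #C := by
        conv_lhs => rw [h1]
        rw [Finset.mul_sum]
        calc ∑ y ∈ R, m * #{ψ ∈ C | ψ (f a) = y} < ∑ y ∈ R, #C :=
              Finset.sum_lt_sum_of_nonempty (Finset.card_pos.1 (by omega)) hcon
          _ = m * #C := by simp [hRcard]
      exact lt_irrefl _ h2
    have hy0 : y ≠ 0 := by
      rintro rfl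
      rw [hR, Polynomial.mem_nthRootsFinset hm, zero_pow hm.ne'] at hy
      exact zero_ne_one hy
    refine ⟨Function.update z a y, ?_, ?_⟩
    · intro b
      by_cases hb : b = a
      · subst hb; simpa using hy0
      · simpa [Function.update_of_ne hb] using hz b
    · have hset : ({ψ : AddChar G ℂ | ∀ b ∈ insert a X, ψ (f b) ≠ Function.update z a y b} :
          Finset (AddChar G ℂ)) = {ψ ∈ C | ψ (f a) ≠ y} := by
        ext ψ
        simp only [hC, Finset.mem_filter, Finset.mem_univ, true_and, Finset.forall_mem_insert,
          Function.update_self]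
        rw [and_comm]
        refine and_congr_left fun _ => forall₂_congr fun b hb => ?_
        rw [Function.update_of_ne (by rintro rfl; exact ha hb)]
      rw [hset, Finset.card_insert_of_notMem ha]
      have hsplit := Finset.card_filter_add_card_filter_not (s := C) (fun ψ => ψ (f a) = y)
      obtain ⟨n, rfl⟩ : ∃ n, m = n + 1 := ⟨m - 1, by omega⟩
      simp only [Nat.add_sub_cancel] at hcard ⊢
      have h3 : #{ψ ∈ C | ψ (f a) ≠ y} * (n + 1) ≤ #C * n := by
        simp only [ne_eq]
        nlinarith
      calc #{ψ ∈ C | ψ (f a) ≠ y} * (n + 1) ^ (#X + 1)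
          = (#{ψ ∈ C | ψ (f a) ≠ y} * (n + 1)) * (n + 1) ^ #X := by ring
        _ ≤ (#C * n) * (n + 1) ^ #X := Nat.mul_le_mul_right _ h3
        _ = (#C * (n + 1) ^ #X) * n := by ring
        _ ≤ (Fintype.card G * n ^ #X) * n := Nat.mul_le_mul_right _ hcard
        _ = _ := by ring

/-- A long enough family in a finite abelian group of exponent dividing `m`
has a nonempty subfamily with zero sum. -/
lemma exists_zero_sum_subset {α G : Type*} [DecidableEq α] [AddCommGroup G] [Fintype G]
    (m : ℕ) (hm : 0 < m) (hexp : ∀ g : G, m • g = 0) (f : α → G) (X : Finset α)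
    (hX : Fintype.card G * (m - 1) ^ #X < m ^ #X) :
    ∃ S ⊆ X, S.Nonempty ∧ ∑ a ∈ S, f a = 0 := by
  classical
  by_contra! hcon
  obtain ⟨z, hz, hcard⟩ := exists_roots_killing_characters m hm hexp f X
  have hempty : #{ψ : AddChar G ℂ | ∀ a ∈ X, ψ (f a) ≠ z a} = 0 := by
    by_contra h
    have : 1 * m ^ #X ≤ #{ψ : AddChar G ℂ | ∀ a ∈ X, ψ (f a) ≠ z a} * m ^ #X :=
      Nat.mul_le_mul_right _ (Nat.one_le_iff_ne_zero.2 h)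
    omega
  have hprod : ∀ ψ : AddChar G ℂ, ∏ a ∈ X, (-ψ (f a) + z a) = 0 := by
    intro ψ
    rw [Finset.card_eq_zero, Finset.filter_eq_empty_iff] at hempty
    have := hempty (Finset.mem_univ ψ)
    push Not at this
    obtain ⟨a, ha, h⟩ := this
    exact Finset.prod_eq_zero ha (by rw [h]; ring)
  have hsum : ∑ ψ : AddChar G ℂ, ∏ a ∈ X, (-ψ (f a) + z a) = 0 :=
    Finset.sum_eq_zero fun ψ _ => hprod ψ
  have hexpand : ∑ ψ : AddChar G ℂ, ∏ a ∈ X, (-ψ (f a) + z a) =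
      ∑ S ∈ X.powerset, (-1) ^ #S * (∏ a ∈ X \ S, z a) *
        ∑ ψ : AddChar G ℂ, ψ (∑ a ∈ S, f a) := by
    simp_rw [Finset.prod_add, Finset.mul_sum]
    rw [Finset.sum_comm]
    refine Finset.sum_congr rfl fun S _ => Finset.sum_congr rfl fun ψ _ => ?_
    have hψ : ψ (∑ a ∈ S, f a) = ∏ a ∈ S, ψ (f a) :=
      map_prod ψ.toMonoidHom (fun a => Multiplicative.ofAdd (f a)) S
    rw [Finset.prod_neg, hψ]
    ring
  rw [hexpand, Finset.sum_eq_single ∅] at hsum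
  · simp only [card_empty, pow_zero, sdiff_empty, one_mul, sum_empty,
      AddChar.map_zero_eq_one, sum_const, nsmul_eq_mul, mul_one, mul_eq_zero] at hsum
    rcases hsum with h | h
    · exact Finset.prod_ne_zero_iff.2 (fun a _ => hz a) h
    · simp at h
  · intro S hS hne
    rw [AddChar.sum_apply_eq_ite, if_neg, mul_zero]
    exact hcon S (Finset.mem_powerset.1 hS) (Finset.nonempty_iff_ne_empty.2 hne)
  · intro h
    exact absurd (Finset.empty_mem_powerset X) h

/-- Every sum of integer vectors agrees modulo `m` with the sum over a small subfamily. -/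
lemma exists_small_subset_sum_modEq {α β : Type*} [DecidableEq α] [Fintype β]
    (m : ℕ) (hm : 0 < m) (hβ : 0 < Fintype.card β) (φ : α → β → ℤ) (X : Finset α) :
    ∃ S ⊆ X, #S ≤ m ^ 2 * Fintype.card β ∧
      ∀ b, (m : ℤ) ∣ ∑ a ∈ X, φ a b - ∑ a ∈ S, φ a b := by
  classical
  have : NeZero m := ⟨hm.ne'⟩
  set D := Fintype.card β with hD
  let f : α → β → ZMod m := fun a b => (φ a b : ZMod m)
  let F : Finset (Finset α) := {S ∈ X.powerset | ∑ a ∈ S, f a = ∑ a ∈ X, f a}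
  obtain ⟨S, hSF, hmin⟩ := F.exists_min_image Finset.card ⟨X, by simp [F]⟩
  obtain ⟨hSX, hS⟩ : S ⊆ X ∧ ∑ a ∈ S, f a = ∑ a ∈ X, f a := by simpa [F] using hSF
  refine ⟨S, hSX, ?_, ?_⟩
  · by_contra! hlt
    have hkey : Fintype.card (β → ZMod m) * (m - 1) ^ #S < m ^ #S := by
      rw [Fintype.card_fun, ZMod.card]
      rcases Nat.eq_or_lt_of_le (Nat.one_le_iff_ne_zero.2 hm.ne') with h1 | h1
      · rw [← h1]
        simp only [Nat.sub_self, one_pow, one_mul]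
        rw [zero_pow (by omega)]
        exact one_pos
      · obtain ⟨n, rfl⟩ : ∃ n, m = n + 1 := ⟨m - 1, by omega⟩
        simp only [Nat.add_sub_cancel]
        have hbern : 2 * n ^ (n + 1) ≤ (n + 1) ^ (n + 1) := by
          have : 2 * n ^ (n + 1) ≤ n ^ (n + 1) + (n + 1) * n ^ n := by
            rw [pow_succ]; nlinarith [pow_pos (show 0 < n by omega) n]
          refine this.trans ?_
          have h4 := add_pow n 1 (n + 1)
          rw [h4, Finset.sum_range_succ, Finset.sum_range_succ]
          simp
          rw [mul_comm]
          omega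
        obtain ⟨q, hq⟩ : ∃ q, #S = (n + 1) * ((n + 1) * D) + q :=
          ⟨#S - (n + 1) * ((n + 1) * D), by
            have : (n + 1) ^ 2 * D = (n + 1) * ((n + 1) * D) := by ring
            omega⟩
        have hn2 : (n + 1) ^ D < 2 ^ ((n + 1) * D) := by
          rw [pow_mul]
          exact Nat.pow_lt_pow_left Nat.lt_two_pow_self (by omega)
        have hnpos : 0 < n := by omega
        rw [hq, pow_add, pow_add, pow_mul, pow_mul (n + 1) (n + 1)]
        calc (n + 1) ^ D * ((n ^ (n + 1)) ^ ((n + 1) * D) * n ^ q)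
            < 2 ^ ((n + 1) * D) * ((n ^ (n + 1)) ^ ((n + 1) * D) * n ^ q) :=
              Nat.mul_lt_mul_of_pos_right hn2 (by positivity)
          _ = (2 * n ^ (n + 1)) ^ ((n + 1) * D) * n ^ q := by rw [mul_pow]; ring
          _ ≤ _ := Nat.mul_le_mul (Nat.pow_le_pow_left hbern _)
              (Nat.pow_le_pow_left (by omega) _)
    obtain ⟨Z, hZS, hZne, hZ⟩ := exists_zero_sum_subset m hm
      (fun g : β → ZMod m => by ext b; simp) f S hkey
    have hmem : S \ Z ∈ F := by
      simp only [F, Finset.mem_filter, Finset.mem_powerset]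
      refine ⟨Finset.sdiff_subset.trans hSX, ?_⟩
      rw [← hS, ← Finset.sum_sdiff hZS, hZ, add_zero]
    have := hmin _ hmem
    have h5 := Finset.card_sdiff_add_card_eq_card hZS
    have := hZne.card_pos
    omega
  · intro b
    have := congrFun hS b
    simp only [Finset.sum_apply, f] at this
    rw [← ZMod.intCast_zmod_eq_zero_iff_dvd] 
    push_cast
    rw [this, sub_self]

end Davenport

section Rounding

open Finset

/-- A fractional selection can be rounded up to a set, changing each of the linear
constraints by at most the number of constraints. -/
lemma exists_rounding {α β : Type*} [Fintype α] [Fintype β] (φ : α → β → ℝ)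
    (h0 : ∀ a b, 0 ≤ φ a b) (h1 : ∀ a b, φ a b ≤ 1) (x : α → ℝ) (hx0 : ∀ a, 0 ≤ x a)
    (hx1 : ∀ a, x a ≤ 1) :
    ∃ Y : Finset α, (∀ a, x a = 1 → a ∈ Y) ∧ (∀ a, x a = 0 → a ∉ Y) ∧
      ∀ b, ∑ a, x a * φ a b ≤ ∑ a ∈ Y, φ a b ∧
        ∑ a ∈ Y, φ a b ≤ ∑ a, x a * φ a b + Fintype.card β := by
  classical
  let L : (α → ℝ) →ₗ[ℝ] (β → ℝ) :=
    { toFun := fun y b => ∑ a, y a * φ a b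
      map_add' := fun y z => by ext b; simp [add_mul, Finset.sum_add_distrib]
      map_smul' := fun c y => by ext b; simp [Finset.mul_sum, mul_assoc] }
  let lo : α → ℝ := fun a => if x a = 1 then 1 else 0
  let hi : α → ℝ := fun a => if x a = 0 then 0 else 1
  let K : Set (α → ℝ) := Set.pi Set.univ (fun a => Set.Icc (lo a) (hi a)) ∩ L ⁻¹' {L x}
  have hK : IsCompact K := by
    refine (isCompact_univ_pi fun a => isCompact_Icc).inter_right ?_
    exact isClosed_singleton.preimage L.continuous_of_finiteDimensional
  have hxK : x ∈ K := by
    refine ⟨fun a _ => ⟨?_, ?_⟩, rfl⟩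
    · by_cases h : x a = 1 <;> simp [lo, h, hx0]
    · by_cases h : x a = 0 <;> simp [hi, h, hx1]
  obtain ⟨y, hyK, hyext⟩ := hK.extremePoints_nonempty ⟨x, hxK⟩
  have hlo : ∀ a, lo a ≤ y a := fun a => (hyK.1 a trivial).1
  have hhi : ∀ a, y a ≤ hi a := fun a => (hyK.1 a trivial).2
  have hlo0 : ∀ a, 0 ≤ lo a := fun a => by simp only [lo]; split_ifs <;> norm_num
  have hhi1 : ∀ a, hi a ≤ 1 := fun a => by simp only [hi]; split_ifs <;> norm_num
  let F : Finset α := {a | 0 < y a ∧ y a < 1}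
  have hFlohi : ∀ a ∈ F, lo a = 0 ∧ hi a = 1 := by
    intro a ha
    obtain ⟨ha0, ha1⟩ : 0 < y a ∧ y a < 1 := by simpa [F] using ha
    refine ⟨?_, ?_⟩
    · simp only [lo]; split_ifs with h
      · have := hlo a; simp only [lo, if_pos h] at this; linarith
      · rfl
    · simp only [hi]; split_ifs with h
      · have := hhi a; simp only [hi, if_pos h] at this; linarith
      · rfl
  have hFcard : #F ≤ Fintype.card β := by
    by_contra! hlt
    let ext : (F → ℝ) →ₗ[ℝ] (α → ℝ) :=
      { toFun := fun z a => if h : a ∈ F then z ⟨a, h⟩ else 0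
        map_add' := fun z w => by ext a; by_cases h : a ∈ F <;> simp [h]
        map_smul' := fun c z => by ext a; by_cases h : a ∈ F <;> simp [h] }
    have hker : LinearMap.ker (L ∘ₗ ext) ≠ ⊥ :=
      LinearMap.ker_ne_bot_of_finrank_lt (by simpa using hlt)
    obtain ⟨z, hz, hzne⟩ := Submodule.exists_mem_ne_zero_of_ne_bot hker
    have hLz : L (ext z) = 0 := by simpa using hz
    have hsmall : ∀ᶠ ε : ℝ in nhds 0, ∀ a : F,
        (0 < y a + ε * z a ∧ y a + ε * z a < 1) ∧ (0 < y a - ε * z a ∧ y a - ε * z a < 1) := by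
      rw [Filter.eventually_all]
      intro a
      obtain ⟨ha0, ha1⟩ : 0 < y a ∧ y a < 1 := (Finset.mem_filter.1 a.2).2
      have c1 : Filter.Tendsto (fun ε : ℝ => y a + ε * z a) (nhds 0) (nhds (y a)) := by
        have : Continuous fun ε : ℝ => y a + ε * z a := by fun_prop
        simpa using this.tendsto 0
      have c2 : Filter.Tendsto (fun ε : ℝ => y a - ε * z a) (nhds 0) (nhds (y a)) := by
        have : Continuous fun ε : ℝ => y a - ε * z a := by fun_prop
        simpa using this.tendsto 0
      exact ((c1.eventually_const_lt ha0).and (c1.eventually_lt_const ha1)).and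
        ((c2.eventually_const_lt ha0).and (c2.eventually_lt_const ha1))
    have hsmall' : ∀ᶠ ε : ℝ in nhdsWithin 0 (Set.Ioi 0), ∀ a : F,
        (0 < y a + ε * z a ∧ y a + ε * z a < 1) ∧ (0 < y a - ε * z a ∧ y a - ε * z a < 1) :=
      hsmall.filter_mono nhdsWithin_le_nhds
    obtain ⟨ε, hε, hεpos⟩ := (hsmall'.and self_mem_nhdsWithin).exists
    have hεpos : 0 < ε := hεpos
    have hp : y + ε • ext z ∈ K := by
      refine ⟨fun a _ => ?_, ?_⟩
      · by_cases h : a ∈ F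
        · change _ ∈ Set.Icc (lo a) (hi a)
          rw [(hFlohi a h).1, (hFlohi a h).2]
          have := (hε ⟨a, h⟩).1
          simp only [ext, LinearMap.coe_mk, AddHom.coe_mk, Pi.add_apply, Pi.smul_apply,
            smul_eq_mul, dif_pos h]
          exact ⟨this.1.le, this.2.le⟩
        · simpa [ext, h] using ⟨hlo a, hhi a⟩
      · have := hyK.2
        simp only [Set.mem_preimage, Set.mem_singleton_iff] at this ⊢
        simp [this, hLz]
    have hm : y - ε • ext z ∈ K := by
      refine ⟨fun a _ => ?_, ?_⟩
      · by_cases h : a ∈ F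
        · change _ ∈ Set.Icc (lo a) (hi a)
          rw [(hFlohi a h).1, (hFlohi a h).2]
          have := (hε ⟨a, h⟩).2
          simp only [ext, LinearMap.coe_mk, AddHom.coe_mk, Pi.sub_apply, Pi.smul_apply,
            smul_eq_mul, dif_pos h]
          exact ⟨this.1.le, this.2.le⟩
        · simpa [ext, h] using ⟨hlo a, hhi a⟩
      · have := hyK.2
        simp only [Set.mem_preimage, Set.mem_singleton_iff] at this ⊢
        simp [this, hLz]
    have hseg : y ∈ openSegment ℝ (y + ε • ext z) (y - ε • ext z) :=
      ⟨1 / 2, 1 / 2, by norm_num, by norm_num, by norm_num, by ext a; simp; ring⟩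
    have heq := hyext hp hm hseg
    apply hzne
    ext a
    have h6 := congrFun heq a
    simp only [ext, LinearMap.coe_mk, AddHom.coe_mk, Pi.add_apply, Pi.smul_apply,
            smul_eq_mul, dif_pos a.2] at h6
    have : ε * z a = 0 := by linarith
    simpa [hεpos.ne'] using this
  let Y : Finset α := {a | 0 < y a}
  have hLy : ∀ b, ∑ a, y a * φ a b = ∑ a, x a * φ a b := fun b => congrFun hyK.2 b
  have hYsum : ∀ b, ∑ a ∈ Y, φ a b = ∑ a, (if 0 < y a then 1 else 0) * φ a b := by
    intro b
    simp [Y, Finset.sum_filter]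
  refine ⟨Y, ?_, ?_, ?_⟩
  · intro a ha
    have := hlo a
    simp only [lo, if_pos ha] at this
    simp only [Y, Finset.mem_filter, Finset.mem_univ, true_and]
    linarith
  · intro a ha
    have := hhi a
    simp only [hi, if_pos ha] at this
    simp only [Y, Finset.mem_filter, Finset.mem_univ, true_and]
    linarith
  · intro b
    rw [hYsum, ← hLy]
    have hy0 : ∀ a, 0 ≤ y a := fun a => (hlo0 a).trans (hlo a)
    have hy1 : ∀ a, y a ≤ 1 := fun a => (hhi a).trans (hhi1 a)
    constructor
    · refine Finset.sum_le_sum fun a _ => mul_le_mul_of_nonneg_right ?_ (h0 a b)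
      split_ifs with h
      · exact hy1 a
      · linarith
    · have h7 : (#F : ℝ) ≤ Fintype.card β := by exact_mod_cast hFcard
      have h8 : (#F : ℝ) = ∑ a, if a ∈ F then (1 : ℝ) else 0 := by simp
      refine le_trans ?_ (add_le_add_right h7 _)
      rw [h8, ← Finset.sum_add_distrib]
      refine Finset.sum_le_sum fun a _ => ?_
      have hφ0 := h0 a b
      have hφ1 := h1 a b
      by_cases hF : a ∈ F
      · rw [if_pos hF]
        have := mul_nonneg (hy0 a) hφ0
        split_ifs <;> linarith
      · rw [if_neg hF]
        simp only [F, Finset.mem_filter, Finset.mem_univ, true_and, not_and, not_lt] at hF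
        split_ifs with h
        · have : y a = 1 := le_antisymm (hy1 a) (hF h)
          rw [this]; linarith
        · have : y a = 0 := le_antisymm (not_lt.1 h) (hy0 a)
          rw [this]; linarith

end Rounding

section Spreading

open Finset

variable {G α β ι : Type*} [Group G] [Fintype G] [MulAction G α] [MulAction G β]
  [Fintype α] [DecidableEq α] [Fintype β] [Fintype ι] [DecidableEq ι]

omit [Fintype G] [DecidableEq α] [Fintype ι] in
lemma card_relation_class_eq [MulAction.IsPretransitive G α] (δ : α → α → ι)
    (hinv : ∀ (g : G) a b, δ (g • a) (g • b) = δ a b) (a a' : α) (i : ι) :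
    #{c | δ a c = i} = #{c | δ a' c = i} := by
  obtain ⟨g, rfl⟩ := MulAction.exists_smul_eq G a a'
  refine Finset.card_bij' (fun c _ => g • c) (fun c _ => g⁻¹ • c) ?_ ?_ ?_ ?_
  · intro c hc
    simpa [hinv] using hc
  · intro c hc
    have := hinv g a (g⁻¹ • c)
    rw [smul_inv_smul] at this
    simpa [← this] using hc
  · intro c _; simp
  · intro c _; simp

omit [Fintype ι] in
/-- Pairs in large relation classes are equidistributed by the stabilizer of the first point. -/
lemma card_smul_fiber_le (δ : α → α → ι)
    (hinv : ∀ (g : G) a b, δ (g • a) (g • b) = δ a b)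
    (horb : ∀ a b a' b', δ a b = δ a' b' → ∃ g : G, g • a = a' ∧ g • b = b')
    [DecidableEq G] (a₀ a b c : α) :
    #{g : G | g • a₀ = a ∧ g • b = c} * #{d | δ a d = δ a₀ b} ≤ #{g : G | g • a₀ = a} := by
  rcases Finset.eq_empty_or_nonempty ({g : G | g • a₀ = a ∧ g • b = c} : Finset G) with h | ⟨g, hg⟩
  · rw [h]; simp
  obtain ⟨hga, hgb⟩ : g • a₀ = a ∧ g • b = c := by simpa using hg
  have hmaps : ∀ h ∈ ({g : G | g • a₀ = a} : Finset G),
      h • b ∈ ({d | δ a d = δ a₀ b} : Finset α) := by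
    intro h hh
    have hh : h • a₀ = a := by simpa using hh
    simp [← hh, hinv]
  rw [Finset.card_eq_sum_card_fiberwise hmaps, mul_comm, ← smul_eq_mul]
  refine Finset.card_nsmul_le_sum _ _ _ fun d hd => ?_
  have hd : δ a d = δ a₀ b := by simpa using hd
  have hc : δ a c = δ a₀ b := by rw [← hga, ← hgb, hinv]
  obtain ⟨k, hka, hkc⟩ := horb a c a d (hc.trans hd.symm)
  refine Finset.card_le_card_of_injOn (fun h => k * h) ?_ ?_
  · intro h hh
    obtain ⟨h1, h2⟩ : h • a₀ = a ∧ h • b = c := by simpa using hh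
    simp [mul_smul, h1, h2, hka, hkc]
  · intro h _ h' _ heq
    exact mul_left_cancel heq

omit [Fintype G] [Fintype β] in
/-- A set of points with pairwise relations in large classes. -/
lemma exists_pairwise_large_classes [MulAction.IsPretransitive G α] (δ : α → α → ι)
    (hinv : ∀ (g : G) a b, δ (g • a) (g • b) = δ a b) (hsymm : ∀ a b, δ a b = δ b a)
    (L s : ℕ) (hLn : L ≤ Fintype.card α) (hs : s * (Fintype.card ι + 1) < L) :
    ∃ F : Finset α, #F = s ∧ ∀ a ∈ F, ∀ b ∈ F, a ≠ b →
      Fintype.card α ≤ L * #{c | δ a c = δ a b} := by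
  set n := Fintype.card α with hn
  set r := Fintype.card ι with hr
  let bad : α → Finset α := fun a => {b | L * #{c | δ a c = δ a b} < n}
  have hbad : ∀ a, L * #(bad a) ≤ r * n := by
    intro a
    let J : Finset ι := {i | L * #{c | δ a c = i} < n}
    have h1 : #(bad a) = ∑ i ∈ J, #{c | δ a c = i} := by
      rw [Finset.card_eq_sum_card_fiberwise (f := δ a) (t := J)]
      · refine Finset.sum_congr rfl fun i hi => ?_
        congr 1
        ext c
        simp only [bad, J, Finset.mem_filter, Finset.mem_univ, true_and] at hi ⊢
        refine ⟨fun h => h.2, fun h => ⟨by rw [h]; exact hi, h⟩⟩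
      · intro c hc
        simpa [bad, J] using hc
    rw [h1, Finset.mul_sum]
    calc ∑ i ∈ J, L * #{c | δ a c = i} ≤ ∑ i ∈ J, n :=
          Finset.sum_le_sum fun i hi => by
            have : L * #{c | δ a c = i} < n := by simpa [J] using hi
            exact this.le
      _ ≤ r * n := by
          simp only [sum_const, smul_eq_mul]
          exact Nat.mul_le_mul_right _ (Finset.card_le_univ _)
  have hlarge_symm : ∀ a b, n ≤ L * #{c | δ a c = δ a b} → n ≤ L * #{c | δ b c = δ b a} := by
    intro a b h
    rwa [hsymm b a, card_relation_class_eq (G := G) δ hinv b a]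
  have key : ∀ s', s' ≤ s → ∃ F : Finset α, #F = s' ∧ ∀ a ∈ F, ∀ b ∈ F, a ≠ b →
      n ≤ L * #{c | δ a c = δ a b} := by
    intro s'
    induction s' with
    | zero => exact fun _ => ⟨∅, by simp⟩
    | succ s' ih =>
      intro hle
      obtain ⟨F, hF, hpair⟩ := ih (by omega)
      have hex : ∃ b, b ∉ F.biUnion (fun a => insert a (bad a)) := by
        by_contra! hall
        have huniv : F.biUnion (fun a => insert a (bad a)) = univ :=
          Finset.eq_univ_iff_forall.2 hall
        have h2 : n ≤ ∑ a ∈ F, #(insert a (bad a)) := by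
          rw [hn, ← Finset.card_univ, ← huniv]
          exact Finset.card_biUnion_le
        have h3 : L * n ≤ s' * (r * n + L) := by
          calc L * n ≤ L * ∑ a ∈ F, #(insert a (bad a)) := Nat.mul_le_mul_left _ h2
            _ = ∑ a ∈ F, L * #(insert a (bad a)) := Finset.mul_sum _ _ _
            _ ≤ ∑ a ∈ F, (r * n + L) := Finset.sum_le_sum fun a _ => by
                have := Finset.card_insert_le a (bad a)
                have := hbad a
                nlinarith
            _ = s' * (r * n + L) := by simp [hF]
        have h4 : s' * (r * n + L) ≤ s * ((r + 1) * n) := by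
          refine Nat.mul_le_mul (by omega) ?_
          nlinarith
        have h5 : s * ((r + 1) * n) < L * n := by
          have : 0 < n := by
            have : 0 < L := by omega
            omega
          nlinarith
        omega
      obtain ⟨b, hb⟩ := hex
      simp only [Finset.mem_biUnion, Finset.mem_insert, not_exists, not_and, not_or] at hb
      have hbF : b ∉ F := fun h => (hb b h).1 rfl
      have hgood : ∀ a ∈ F, n ≤ L * #{c | δ a c = δ a b} := by
        intro a ha
        have := (hb a ha).2
        simpa [bad] using this
      refine ⟨insert b F, by rw [Finset.card_insert_of_notMem hbF, hF], ?_⟩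
      intro a ha c hc hac
      rcases Finset.mem_insert.1 ha with rfl | ha' <;> rcases Finset.mem_insert.1 hc with rfl | hc'
      · exact absurd rfl hac
      · exact hlarge_symm _ _ (hgood c hc')
      · exact hgood a ha'
      · exact hpair a ha' c hc' hac
  exact key s le_rfl

omit [Fintype α] in
/-- Pigeonhole: a large family of bounded integer vectors contains two disjoint
subfamilies with the same sum. -/
lemma exists_disjoint_equal_sums (φ : α → β → ℤ) (h0 : ∀ a b, 0 ≤ φ a b)
    (h1 : ∀ a b, φ a b ≤ 1) (F : Finset α) (hF : (#F + 1) ^ Fintype.card β < 2 ^ #F) :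
    ∃ P Q : Finset α, P ⊆ F ∧ Q ⊆ F ∧ Disjoint P Q ∧ P.Nonempty ∧
      ∀ b, ∑ a ∈ P, φ a b = ∑ a ∈ Q, φ a b := by
  classical
  have hcard : #(Fintype.piFinset fun _ : β => Finset.Icc (0 : ℤ) #F) < #F.powerset := by
    rw [Fintype.card_piFinset, Finset.card_powerset]
    simpa using hF
  have hmaps : ∀ S ∈ F.powerset, (fun b => ∑ a ∈ S, φ a b) ∈
      (Fintype.piFinset fun _ : β => Finset.Icc (0 : ℤ) #F) := by
    intro S hS
    rw [Fintype.mem_piFinset]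
    intro b
    rw [Finset.mem_Icc]
    refine ⟨Finset.sum_nonneg fun a _ => h0 a b, ?_⟩
    calc ∑ a ∈ S, φ a b ≤ ∑ a ∈ S, 1 := Finset.sum_le_sum fun a _ => h1 a b
      _ = #S := by simp
      _ ≤ #F := by exact_mod_cast Finset.card_le_card (Finset.mem_powerset.1 hS)
  obtain ⟨P, hP, Q, hQ, hne, heq⟩ := Finset.exists_ne_map_eq_of_card_lt_of_maps_to hcard hmaps
  have hsum : ∀ b, ∑ a ∈ P \ Q, φ a b = ∑ a ∈ Q \ P, φ a b := by
    intro b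
    have h2 : ∑ a ∈ P, φ a b = ∑ a ∈ Q, φ a b := congrFun heq b
    have h3 := Finset.sum_inter_add_sum_sdiff P Q (fun a => φ a b)
    have h4 := Finset.sum_inter_add_sum_sdiff Q P (fun a => φ a b)
    rw [Finset.inter_comm] at h4
    linarith
  have hd : Disjoint (P \ Q) (Q \ P) := disjoint_sdiff_sdiff
  have hPF := Finset.mem_powerset.1 hP
  have hQF := Finset.mem_powerset.1 hQ
  by_cases hPQ : (P \ Q).Nonempty
  · exact ⟨P \ Q, Q \ P, sdiff_subset.trans hPF, sdiff_subset.trans hQF, hd, hPQ, hsum⟩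
  · refine ⟨Q \ P, P \ Q, sdiff_subset.trans hQF, sdiff_subset.trans hPF, hd.symm, ?_,
      fun b => (hsum b).symm⟩
    rw [Finset.nonempty_iff_ne_empty]
    intro h
    rw [Finset.not_nonempty_iff_eq_empty, Finset.sdiff_eq_empty_iff_subset] at hPQ
    rw [Finset.sdiff_eq_empty_iff_subset] at h
    exact hne (Finset.Subset.antisymm hPQ h)

omit [Fintype G] [MulAction G β] in
/-- A trade that can be moved so that it simulates any given point. -/
lemma exists_large_class_trade [MulAction.IsPretransitive G α] (φ : α → β → ℤ)
    (h0 : ∀ a b, 0 ≤ φ a b) (h1 : ∀ a b, φ a b ≤ 1) (δ : α → α → ι)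
    (hinv : ∀ (g : G) a b, δ (g • a) (g • b) = δ a b) (hsymm : ∀ a b, δ a b = δ b a)
    (L s : ℕ) (hLn : L ≤ Fintype.card α) (hs : s * (Fintype.card ι + 1) < L)
    (hpow : (s + 1) ^ Fintype.card β < 2 ^ s) :
    ∃ (a₀ : α) (P Q : Finset α), Disjoint P Q ∧ #(P ∪ Q) ≤ s ∧
      (∀ b, ∑ a ∈ Q, φ a b - ∑ a ∈ P, φ a b = φ a₀ b) ∧
      ∀ b ∈ P ∪ Q, Fintype.card α ≤ L * #{c | δ a₀ c = δ a₀ b} := by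
  obtain ⟨F, rfl, hF⟩ := exists_pairwise_large_classes (G := G) δ hinv hsymm L s hLn hs
  obtain ⟨P, Q, hPF, hQF, hd, ⟨a₀, ha₀⟩, hsum⟩ := exists_disjoint_equal_sums φ h0 h1 F hpow
  refine ⟨a₀, P.erase a₀, Q, ?_, ?_, ?_, ?_⟩
  · exact Finset.disjoint_of_subset_left (Finset.erase_subset _ _) hd
  · exact Finset.card_le_card
      (Finset.union_subset ((Finset.erase_subset _ _).trans hPF) hQF)
  · intro b
    rw [← hsum b, ← Finset.add_sum_erase P _ ha₀]
    ring
  · intro b hb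
    have hbF : b ∈ F := by
      rcases Finset.mem_union.1 hb with h | h
      · exact hPF (Finset.mem_of_mem_erase h)
      · exact hQF h
    refine hF a₀ (hPF ha₀) b hbF ?_
    rintro rfl
    rcases Finset.mem_union.1 hb with h | h
    · exact Finset.notMem_erase _ _ h
    · exact Finset.disjoint_left.1 hd ha₀ h

omit [Fintype ι] in
/-- Group elements moving `a₀` to `a` mostly move a trade away from a small forbidden set. -/
lemma card_le_two_mul_card_avoiding (δ : α → α → ι)
    (hinv : ∀ (g : G) a b, δ (g • a) (g • b) = δ a b)
    (horb : ∀ a b a' b', δ a b = δ a' b' → ∃ g : G, g • a = a' ∧ g • b = b')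
    [MulAction.IsPretransitive G α] [DecidableEq G] (L : ℕ) (a₀ a : α) (R E : Finset α)
    (hR : ∀ b ∈ R, Fintype.card α ≤ L * #{c | δ a₀ c = δ a₀ b})
    (hE : 2 * (#R * #E * L) ≤ Fintype.card α) :
    #{g : G | g • a₀ = a} ≤ 2 * #{g : G | g • a₀ = a ∧ ∀ b ∈ R, g • b ∉ E} ∧
      ∀ b ∈ R, ∀ c, Fintype.card α * #{g : G | g • a₀ = a ∧ g • b = c} ≤
        L * #{g : G | g • a₀ = a} := by
  set n := Fintype.card α with hn
  have hfib : ∀ b ∈ R, ∀ c, n * #{g : G | g • a₀ = a ∧ g • b = c} ≤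
        L * #{g : G | g • a₀ = a} := by
    intro b hb c
    have h2 := card_smul_fiber_le (G := G) δ hinv horb a₀ a b c
    have h3 := hR b hb
    rw [card_relation_class_eq (G := G) δ hinv a₀ a] at h3
    calc n * #{g : G | g • a₀ = a ∧ g • b = c}
        ≤ (L * #{d | δ a d = δ a₀ b}) * #{g : G | g • a₀ = a ∧ g • b = c} :=
          Nat.mul_le_mul_right _ h3
      _ = L * (#{g : G | g • a₀ = a ∧ g • b = c} * #{d | δ a d = δ a₀ b}) := by ring
      _ ≤ _ := Nat.mul_le_mul_left _ h2
  refine ⟨?_, hfib⟩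
  have hn0 : 0 < n := Fintype.card_pos_iff.2 ⟨a⟩
  set S := #{g : G | g • a₀ = a} with hS
  have hcover : ({g : G | g • a₀ = a} : Finset G) ⊆
      ({g : G | g • a₀ = a ∧ ∀ b ∈ R, g • b ∉ E} : Finset G) ∪
        (R ×ˢ E).biUnion fun p => {g : G | g • a₀ = a ∧ g • p.1 = p.2} := by
    intro g hg
    have hg : g • a₀ = a := by simpa using hg
    by_cases h : ∀ b ∈ R, g • b ∉ E
    · exact Finset.mem_union_left _ (by simpa using ⟨hg, h⟩)
    · push Not at h
      obtain ⟨b, hb, hbE⟩ := h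
      refine Finset.mem_union_right _ (Finset.mem_biUnion.2 ⟨(b, g • b), ?_, ?_⟩)
      · simp [hb, hbE]
      · simp [hg]
  have h4 : S ≤ #{g : G | g • a₀ = a ∧ ∀ b ∈ R, g • b ∉ E} +
      ∑ p ∈ R ×ˢ E, #{g : G | g • a₀ = a ∧ g • p.1 = p.2} :=
    (Finset.card_le_card hcover).trans ((Finset.card_union_le _ _).trans
      (Nat.add_le_add_left Finset.card_biUnion_le _))
  have h5 : n * ∑ p ∈ R ×ˢ E, #{g : G | g • a₀ = a ∧ g • p.1 = p.2} ≤ #R * #E * (L * S) := by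
    rw [Finset.mul_sum]
    calc _ ≤ ∑ p ∈ R ×ˢ E, L * S := Finset.sum_le_sum fun p hp =>
          hfib p.1 (Finset.mem_product.1 hp).1 p.2
      _ = _ := by simp
  have h6 : 2 * (n * S) ≤ n * (2 * #{g : G | g • a₀ = a ∧ ∀ b ∈ R, g • b ∉ E}) + n * S := by
    have : 2 * (#R * #E * (L * S)) ≤ n * S := by
      calc 2 * (#R * #E * (L * S)) = (2 * (#R * #E * L)) * S := by ring
        _ ≤ n * S := Nat.mul_le_mul_right _ hE
    nlinarith
  have h7 : n * S ≤ n * (2 * #{g : G | g • a₀ = a ∧ ∀ b ∈ R, g • b ∉ E}) := by omega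
  exact Nat.le_of_mul_le_mul_left h7 hn0

/-- Every point can be simulated, away from any small forbidden set, by a small trade and
by a spread-out real combination of points. -/
lemma exists_simulation [MulAction.IsPretransitive G α] (φ : α → β → ℤ)
    (hφ : ∀ (g : G) a b, φ (g • a) (g • b) = φ a b)
    (h0 : ∀ a b, 0 ≤ φ a b) (h1 : ∀ a b, φ a b ≤ 1) (δ : α → α → ι)
    (hinv : ∀ (g : G) a b, δ (g • a) (g • b) = δ a b) (hsymm : ∀ a b, δ a b = δ b a)
    (horb : ∀ a b a' b', δ a b = δ a' b' → ∃ g : G, g • a = a' ∧ g • b = b')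
    (L s W : ℕ) (hLn : L ≤ Fintype.card α) (hs : s * (Fintype.card ι + 1) < L)
    (hpow : (s + 1) ^ Fintype.card β < 2 ^ s) (hW : 2 * (s * W * L) ≤ Fintype.card α)
    (a : α) (E : Finset α) (hE : #E ≤ W) :
    (∃ P Q : Finset α, Disjoint P Q ∧ Disjoint E (P ∪ Q) ∧ #(P ∪ Q) ≤ s ∧
      ∀ b, ∑ c ∈ Q, φ c b - ∑ c ∈ P, φ c b = φ a b) ∧
    ∃ f : α → ℝ, (∀ c ∈ E, f c = 0) ∧ (∀ b, ∑ c, f c * φ c b = φ a b) ∧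
      ∀ c, |f c| * Fintype.card α ≤ 2 * s * L := by
  classical
  obtain ⟨a₀, P, Q, hd, hcard, hsum, hlarge⟩ :=
    exists_large_class_trade (G := G) φ h0 h1 δ hinv hsymm L s hLn hs hpow
  have hEs : 2 * (#(P ∪ Q) * #E * L) ≤ Fintype.card α := by
    refine le_trans ?_ hW
    gcongr
  obtain ⟨hhalf, hfib⟩ := card_le_two_mul_card_avoiding (G := G) δ hinv horb L a₀ a (P ∪ Q) E
    hlarge hEs
  set S : Finset G := {g : G | g • a₀ = a ∧ ∀ b ∈ P ∪ Q, g • b ∉ E} with hS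
  have hT0 : 0 < #{g : G | g • a₀ = a} := by
    obtain ⟨g, hg⟩ := MulAction.exists_smul_eq G a₀ a
    exact Finset.card_pos.2 ⟨g, by simpa using hg⟩
  have hS0 : 0 < #S := by omega
  have hmem : ∀ g ∈ S, g • a₀ = a ∧ ∀ b ∈ P ∪ Q, g • b ∉ E := by
    intro g hg
    simpa only [hS, Finset.mem_filter, Finset.mem_univ, true_and] using hg
  have hmove : ∀ g ∈ S, ∀ b, ∑ c ∈ Q, φ (g • c) b - ∑ c ∈ P, φ (g • c) b = φ a b := by
    intro g hg b
    have h2 := hsum (g⁻¹ • b)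
    have h3 : ∀ c, φ (g • c) b = φ c (g⁻¹ • b) := by
      intro c
      conv_lhs => rw [← smul_inv_smul g b]
      exact hφ g c _
    simp_rw [h3, h2]
    rw [← h3, (hmem g hg).1]
  constructor
  · obtain ⟨g, hg⟩ := Finset.card_pos.1 hS0
    have hinj : Function.Injective (fun c : α => g • c) := MulAction.injective g
    refine ⟨P.image (g • ·), Q.image (g • ·), ?_, ?_, ?_, ?_⟩
    · exact (Finset.disjoint_image hinj).2 hd
    · rw [← Finset.image_union, Finset.disjoint_right]
      intro c hc
      obtain ⟨b, hb, rfl⟩ := Finset.mem_image.1 hc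
      exact (hmem g hg).2 b hb
    · rw [← Finset.image_union]
      exact Finset.card_image_le.trans hcard
    · intro b
      rw [Finset.sum_image hinj.injOn, Finset.sum_image hinj.injOn]
      exact hmove g hg b
  · have hSR : (0 : ℝ) < #S := by exact_mod_cast hS0
    refine ⟨fun c => (∑ g ∈ S, ((∑ d ∈ Q, if g • d = c then (1 : ℝ) else 0) -
      ∑ d ∈ P, if g • d = c then (1 : ℝ) else 0)) / #S, ?_, ?_, ?_⟩
    · intro c hc
      rw [div_eq_zero_iff]
      left
      refine Finset.sum_eq_zero fun g hg => ?_
      have hz : ∀ R ⊆ P ∪ Q, ∑ d ∈ R, (if g • d = c then (1 : ℝ) else 0) = 0 := by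
        intro R hR
        refine Finset.sum_eq_zero fun d hd => if_neg ?_
        rintro rfl
        exact (hmem g hg).2 d (hR hd) hc
      rw [hz Q subset_union_right, hz P subset_union_left, sub_zero]
    · intro b
      have hswap : ∀ g : G, ∀ R : Finset α,
          ∑ c, (∑ d ∈ R, if g • d = c then (1 : ℝ) else 0) * (φ c b : ℝ) =
            ∑ d ∈ R, (φ (g • d) b : ℝ) := by
        intro g R
        simp_rw [Finset.sum_mul]
        rw [Finset.sum_comm]
        refine Finset.sum_congr rfl fun d _ => ?_
        simp
      simp_rw [div_mul_eq_mul_div]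
      rw [← Finset.sum_div, div_eq_iff hSR.ne']
      simp_rw [Finset.sum_mul]
      rw [Finset.sum_comm]
      calc _ = ∑ g ∈ S, (φ a b : ℝ) := by
            refine Finset.sum_congr rfl fun g hg => ?_
            simp_rw [sub_mul]
            rw [Finset.sum_sub_distrib, hswap, hswap]
            exact_mod_cast hmove g hg b
        _ = _ := by simp [mul_comm]
    · intro c
      have hbound : |∑ g ∈ S, ((∑ d ∈ Q, if g • d = c then (1 : ℝ) else 0) -
          ∑ d ∈ P, if g • d = c then (1 : ℝ) else 0)| ≤
          ∑ d ∈ P ∪ Q, (#{g : G | g • a₀ = a ∧ g • d = c} : ℝ) := by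
        refine (Finset.abs_sum_le_sum_abs _ _).trans ?_
        have h4 : ∀ g ∈ S, |(∑ d ∈ Q, if g • d = c then (1 : ℝ) else 0) -
            ∑ d ∈ P, if g • d = c then (1 : ℝ) else 0| ≤
            ∑ d ∈ P ∪ Q, if g • d = c then (1 : ℝ) else 0 := by
          intro g _
          rw [Finset.sum_union hd]
          have hP : 0 ≤ ∑ d ∈ P, if g • d = c then (1 : ℝ) else 0 :=
            Finset.sum_nonneg fun d _ => by split_ifs <;> norm_num
          have hQ : 0 ≤ ∑ d ∈ Q, if g • d = c then (1 : ℝ) else 0 :=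
            Finset.sum_nonneg fun d _ => by split_ifs <;> norm_num
          rw [abs_le]
          constructor <;> linarith
        refine (Finset.sum_le_sum h4).trans ?_
        rw [Finset.sum_comm]
        refine Finset.sum_le_sum fun d _ => ?_
        rw [Finset.sum_ite, Finset.sum_const_zero, add_zero, Finset.sum_const, nsmul_eq_mul,
          mul_one]
        norm_cast
        refine Finset.card_le_card fun g hg => ?_
        rw [Finset.mem_filter] at hg
        simp [(hmem g hg.1).1, hg.2]
      have h5 : (Fintype.card α : ℝ) * ∑ d ∈ P ∪ Q, (#{g : G | g • a₀ = a ∧ g • d = c} : ℝ) ≤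
          s * (L * (2 * #S)) := by
        rw [Finset.mul_sum]
        calc _ ≤ ∑ d ∈ P ∪ Q, (L * (2 * #S) : ℝ) := by
              refine Finset.sum_le_sum fun d hd => ?_
              have h6 := hfib d hd c
              have h7 : Fintype.card α * #{g : G | g • a₀ = a ∧ g • d = c} ≤ L * (2 * #S) :=
                h6.trans (Nat.mul_le_mul_left _ hhalf)
              exact_mod_cast h7
          _ = #(P ∪ Q) * (L * (2 * #S) : ℝ) := by simp
          _ ≤ _ := by gcongr
      rw [abs_div, Nat.abs_cast, div_mul_eq_mul_div, div_le_iff₀ hSR]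
      calc _ ≤ (∑ d ∈ P ∪ Q, (#{g : G | g • a₀ = a ∧ g • d = c} : ℝ)) * Fintype.card α := by
            gcongr
        _ ≤ _ := by linarith

end Spreading

section Absorption

open Finset

variable {α β : Type*} [DecidableEq α]

/-- Simulations of single points combine to simulations of integer combinations of points. -/
lemma exists_simulation_combination [Fintype α] (φ : α → β → ℤ) (s W : ℕ)
    (hsim : ∀ (a : α) (E : Finset α), #E ≤ W → ∃ P Q : Finset α, Disjoint P Q ∧
      Disjoint E (P ∪ Q) ∧ #(P ∪ Q) ≤ s ∧ ∀ b, ∑ c ∈ Q, φ c b - ∑ c ∈ P, φ c b = φ a b)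
    (k : ℕ) : ∀ (γ : α → ℤ) (E : Finset α), ∑ a, (γ a).natAbs ≤ k → #E + k * s ≤ W →
      ∃ P Q : Finset α, Disjoint P Q ∧ Disjoint E (P ∪ Q) ∧ #(P ∪ Q) ≤ k * s ∧
        ∀ b, ∑ c ∈ Q, φ c b - ∑ c ∈ P, φ c b = ∑ a, γ a * φ a b := by
  induction k with
  | zero =>
    intro γ E hγ _
    have hγ0 : ∀ a, γ a = 0 := by
      intro a
      have : (γ a).natAbs ≤ ∑ a, (γ a).natAbs :=
        Finset.single_le_sum (f := fun a => (γ a).natAbs) (fun _ _ => Nat.zero_le _)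
          (Finset.mem_univ a)
      omega
    exact ⟨∅, ∅, by simp, by simp, by simp, by simp [hγ0]⟩
  | succ k ih =>
    intro γ E hγ hE
    by_cases hall : ∀ a, γ a = 0
    · exact ⟨∅, ∅, by simp, by simp, by simp, by simp [hall]⟩
    push Not at hall
    obtain ⟨a, ha⟩ := hall
    have hks : (k + 1) * s = k * s + s := by ring
    let γ' : α → ℤ := Function.update γ a (γ a - (γ a).sign)
    have hγ'a : γ' a = γ a - (γ a).sign := by simp [γ']
    have hγ'ne : ∀ c ∈ univ.erase a, γ' c = γ c := fun c hc => by
      simp [γ', Function.update_of_ne (Finset.ne_of_mem_erase hc)]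
    have hγ' : ∑ c, (γ' c).natAbs ≤ k := by
      rw [← Finset.add_sum_erase univ _ (Finset.mem_univ a)] at hγ ⊢
      rw [Finset.sum_congr rfl fun c hc => by rw [hγ'ne c hc], hγ'a]
      rcases lt_or_gt_of_ne ha with h | h
      · rw [Int.sign_eq_neg_one_of_neg h]; omega
      · rw [Int.sign_eq_one_of_pos h]; omega
    obtain ⟨P, Q, hd, hdE, hcard, hsum⟩ := ih γ' E hγ' (by omega)
    obtain ⟨P₁, Q₁, hd₁, hdE₁, hcard₁, hsum₁⟩ := hsim a (E ∪ (P ∪ Q)) (by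
      have := Finset.card_union_le E (P ∪ Q)
      omega)
    obtain ⟨P₂, Q₂, hPQ₂, hd₂, hsum₂⟩ : ∃ P₂ Q₂ : Finset α, P₂ ∪ Q₂ = P₁ ∪ Q₁ ∧ Disjoint P₂ Q₂ ∧
        ∀ b, ∑ c ∈ Q₂, φ c b - ∑ c ∈ P₂, φ c b = (γ a).sign * φ a b := by
      rcases lt_or_gt_of_ne ha with h | h
      · refine ⟨Q₁, P₁, Finset.union_comm _ _, hd₁.symm, fun b => ?_⟩
        rw [Int.sign_eq_neg_one_of_neg h, ← hsum₁ b]; ring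
      · refine ⟨P₁, Q₁, rfl, hd₁, fun b => ?_⟩
        rw [Int.sign_eq_one_of_pos h, ← hsum₁ b]; ring
    rw [← hPQ₂] at hdE₁ hcard₁
    have hdPQ : Disjoint (P ∪ Q) (P₂ ∪ Q₂) :=
      Finset.disjoint_of_subset_left Finset.subset_union_right hdE₁
    have hPP : Disjoint P P₂ := Finset.disjoint_of_subset_left Finset.subset_union_left
      (Finset.disjoint_of_subset_right Finset.subset_union_left hdPQ)
    have hPQ : Disjoint P Q₂ := Finset.disjoint_of_subset_left Finset.subset_union_left
      (Finset.disjoint_of_subset_right Finset.subset_union_right hdPQ)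
    have hQP : Disjoint Q P₂ := Finset.disjoint_of_subset_left Finset.subset_union_right
      (Finset.disjoint_of_subset_right Finset.subset_union_left hdPQ)
    have hQQ : Disjoint Q Q₂ := Finset.disjoint_of_subset_left Finset.subset_union_right
      (Finset.disjoint_of_subset_right Finset.subset_union_right hdPQ)
    have hun : (P ∪ P₂) ∪ (Q ∪ Q₂) = (P ∪ Q) ∪ (P₂ ∪ Q₂) := Finset.union_union_union_comm _ _ _ _
    refine ⟨P ∪ P₂, Q ∪ Q₂, ?_, ?_, ?_, ?_⟩
    · simp only [Finset.disjoint_union_left, Finset.disjoint_union_right]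
      exact ⟨⟨hd, hQP.symm⟩, hPQ, hd₂⟩
    · rw [hun, Finset.disjoint_union_right]
      exact ⟨hdE, Finset.disjoint_of_subset_left Finset.subset_union_left hdE₁⟩
    · rw [hun]
      have := Finset.card_union_le (P ∪ Q) (P₂ ∪ Q₂)
      omega
    · intro b
      rw [Finset.sum_union hQQ, Finset.sum_union hPP]
      have h1 := hsum b
      have h2 := hsum₂ b
      rw [← Finset.add_sum_erase univ _ (Finset.mem_univ a)] at h1 ⊢
      have h3 : ∑ c ∈ univ.erase a, γ' c * φ c b = ∑ c ∈ univ.erase a, γ c * φ c b :=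
        Finset.sum_congr rfl fun c hc => by rw [hγ'ne c hc]
      rw [h3, hγ'a] at h1
      linarith

/-- Greedy choice of pairwise disjoint pairs of sets. -/
lemma exists_pairwise_disjoint_pairs {κ : Type*} [DecidableEq κ]
    (R : κ → Finset α → Finset α → Prop) (w V : ℕ)
    (h : ∀ (i : κ) (E : Finset α), #E ≤ V → ∃ P Q : Finset α, Disjoint P Q ∧
      Disjoint E (P ∪ Q) ∧ #(P ∪ Q) ≤ w ∧ R i P Q) (I : Finset κ) (hI : #I * w ≤ V) :
    ∃ P Q : κ → Finset α, (∀ i ∈ I, Disjoint (P i) (Q i) ∧ #(P i ∪ Q i) ≤ w ∧ R i (P i) (Q i)) ∧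
      ∀ i ∈ I, ∀ j ∈ I, i ≠ j → Disjoint (P i ∪ Q i) (P j ∪ Q j) := by
  induction I using Finset.induction_on with
  | empty => exact ⟨fun _ => ∅, fun _ => ∅, by simp, by simp⟩
  | insert k I hk ih =>
    rw [Finset.card_insert_of_notMem hk] at hI
    have hI' : #I * w ≤ V := le_trans (Nat.mul_le_mul_right _ (Nat.le_succ _)) hI
    obtain ⟨P, Q, hPQ, hpair⟩ := ih hI'
    obtain ⟨P₁, Q₁, hd, hdE, hcard, hR⟩ := h k (I.biUnion fun i => P i ∪ Q i) (by
      refine (Finset.card_biUnion_le_card_mul _ _ w fun i hi => (hPQ i hi).2.1).trans hI')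
    have hdI : ∀ i ∈ I, Disjoint (P i ∪ Q i) (P₁ ∪ Q₁) := fun i hi =>
      Finset.disjoint_of_subset_left
        (Finset.subset_biUnion_of_mem (fun i => P i ∪ Q i) hi) hdE
    have hne : ∀ i ∈ I, i ≠ k := by rintro i hi rfl; exact hk hi
    refine ⟨Function.update P k P₁, Function.update Q k Q₁, ?_, ?_⟩
    · intro i hi
      rcases Finset.mem_insert.1 hi with rfl | hi
      · simpa using ⟨hd, hcard, hR⟩
      · simpa [Function.update_of_ne (hne i hi)] using hPQ i hi
    · intro i hi j hj hij
      rcases Finset.mem_insert.1 hi with rfl | hi' <;> rcases Finset.mem_insert.1 hj with rfl | hj'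
      · exact absurd rfl hij
      · simpa [Function.update_of_ne (hne j hj')] using (hdI j hj').symm
      · simpa [Function.update_of_ne (hne i hi')] using hdI i hi'
      · simpa [Function.update_of_ne (hne j hj'), Function.update_of_ne (hne i hi')] using
          hpair i hi' j hj' hij

/-- A selection of density `p` respecting prescribed values on a small set. -/
lemma exists_fractional_selection [Fintype α] (φ : α → β → ℤ) (W B : ℕ)
    (hsim : ∀ (a : α) (E : Finset α), #E ≤ W → ∃ f : α → ℝ, (∀ c ∈ E, f c = 0) ∧
      (∀ b, ∑ c, f c * φ c b = φ a b) ∧ ∀ c, |f c| * Fintype.card α ≤ B)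
    (P Q : Finset α) (hPQ : Disjoint P Q) (hW : #(P ∪ Q) ≤ W) (p : ℝ) (hp2 : 2 * p ≤ 1)
    (hp : (W * B : ℝ) ≤ p * Fintype.card α) :
    ∃ x : α → ℝ, (∀ a, 0 ≤ x a) ∧ (∀ a, x a ≤ 1) ∧ (∀ a ∈ P, x a = 1) ∧ (∀ a ∈ Q, x a = 0) ∧
      ∀ b, ∑ a, x a * φ a b = p * ∑ a, (φ a b : ℝ) := by
  choose f hf0 hfφ hfB using fun a => hsim a (P ∪ Q) hW
  rcases isEmpty_or_nonempty α with hα | hα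
  · exact ⟨fun _ => 0, fun a => (hα.false a).elim, fun a => (hα.false a).elim,
      fun a => (hα.false a).elim, fun a => (hα.false a).elim, by simp⟩
  have hn : (0 : ℝ) < Fintype.card α := by exact_mod_cast Fintype.card_pos
  have hp0 : 0 ≤ p := by
    by_contra! h
    have : p * Fintype.card α < 0 := mul_neg_of_neg_of_pos h hn
    have : (0 : ℝ) ≤ W * B := by positivity
    linarith
  let w : α → ℝ := fun e => if e ∈ P then p - 1 else p
  have hw : ∀ e, |w e| ≤ 1 := by
    intro e
    simp only [w]
    split_ifs <;> rw [abs_le] <;> constructor <;> linarith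
  let x : α → ℝ := fun c => p + ∑ e ∈ P ∪ Q, w e * (f e c - if e = c then 1 else 0)
  have hxin : ∀ c ∈ P ∪ Q, x c = p - w c := by
    intro c hc
    simp only [x]
    rw [Finset.sum_congr rfl fun e _ => by rw [hf0 e c hc]]
    simp [hc, sub_eq_add_neg]
  have hxP : ∀ c ∈ P, x c = 1 := by
    intro c hc
    rw [hxin c (Finset.mem_union_left _ hc)]
    simp [w, hc]
  have hxQ : ∀ c ∈ Q, x c = 0 := by
    intro c hc
    rw [hxin c (Finset.mem_union_right _ hc)]
    simp [w, Finset.disjoint_right.1 hPQ hc]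
  have hxout : ∀ c, c ∉ P ∪ Q → |x c - p| ≤ p := by
    intro c hc
    have h1 : x c - p = ∑ e ∈ P ∪ Q, w e * f e c := by
      simp only [x, add_sub_cancel_left]
      refine Finset.sum_congr rfl fun e he => ?_
      rw [if_neg (by rintro rfl; exact hc he), sub_zero]
    rw [h1, ← mul_le_mul_iff_left₀ hn]
    refine le_trans ?_ hp
    calc |∑ e ∈ P ∪ Q, w e * f e c| * Fintype.card α
        ≤ (∑ e ∈ P ∪ Q, |f e c|) * Fintype.card α := by
          gcongr
          refine (Finset.abs_sum_le_sum_abs _ _).trans (Finset.sum_le_sum fun e _ => ?_)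
          rw [abs_mul]
          exact mul_le_of_le_one_left (abs_nonneg _) (hw e)
      _ = ∑ e ∈ P ∪ Q, |f e c| * Fintype.card α := Finset.sum_mul _ _ _
      _ ≤ ∑ e ∈ P ∪ Q, (B : ℝ) := Finset.sum_le_sum fun e _ => hfB e c
      _ = #(P ∪ Q) * B := by simp
      _ ≤ W * B := by gcongr
  refine ⟨x, ?_, ?_, hxP, hxQ, ?_⟩
  · intro c
    by_cases hc : c ∈ P ∪ Q
    · rcases Finset.mem_union.1 hc with h | h
      · rw [hxP c h]; norm_num
      · rw [hxQ c h]
    · have := (abs_le.1 (hxout c hc)).1; linarith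
  · intro c
    by_cases hc : c ∈ P ∪ Q
    · rcases Finset.mem_union.1 hc with h | h
      · rw [hxP c h]
      · rw [hxQ c h]; norm_num
    · have := (abs_le.1 (hxout c hc)).2; linarith
  · intro b
    simp only [x, add_mul, Finset.sum_add_distrib, Finset.sum_mul]
    rw [Finset.sum_comm, ← Finset.mul_sum]
    rw [add_eq_left]
    refine Finset.sum_eq_zero fun e _ => ?_
    simp_rw [mul_assoc, sub_mul]
    rw [← Finset.mul_sum, Finset.sum_sub_distrib, hfφ]
    simp

/-- Exact selection: if single points can be simulated robustly and the vectors `m • e_b` are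
small combinations of points, then any suitable constant multiple of `m` is attained. -/
lemma exists_exact_selection [Fintype α] [Fintype β] [Nonempty β] (φ : α → β → ℤ)
    (h0 : ∀ a b, 0 ≤ φ a b) (h1 : ∀ a b, φ a b ≤ 1) (s W B A m lam Lam : ℕ) (hm : 0 < m)
    (hsim : ∀ (a : α) (E : Finset α), #E ≤ W → ∃ P Q : Finset α, Disjoint P Q ∧
      Disjoint E (P ∪ Q) ∧ #(P ∪ Q) ≤ s ∧ ∀ b, ∑ c ∈ Q, φ c b - ∑ c ∈ P, φ c b = φ a b)
    (hsim' : ∀ (a : α) (E : Finset α), #E ≤ W → ∃ f : α → ℝ, (∀ c ∈ E, f c = 0) ∧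
      (∀ b, ∑ c, f c * φ c b = φ a b) ∧ ∀ c, |f c| * Fintype.card α ≤ B)
    (γ : β → α → ℤ) (hγA : ∀ b, ∑ a, (γ b a).natAbs ≤ A)
    (hγ : ∀ b b', b' ≠ b → ∑ a, γ b a * φ a b' = 0) (hγm : ∀ b, ∑ a, γ b a * φ a b = m)
    (hLam : ∀ b, ∑ a, φ a b = Lam) (hmlam : m ∣ lam) (hLam2 : 2 * lam ≤ Lam)
    (hW : (Fintype.card β * (2 * (Fintype.card β + 2 * (m ^ 2 * Fintype.card β))) + 1) *
      (A * s) ≤ W)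
    (hB : Lam * (W * B) ≤ lam * Fintype.card α) :
    ∃ X : Finset α, ∀ b, ∑ a ∈ X, φ a b = lam := by
  classical
  set D := Fintype.card β with hD
  have hDpos : 0 < D := Fintype.card_pos
  set K := D + 2 * (m ^ 2 * D) with hK
  -- the absorbing gadgets
  let τ : β × Bool × Fin K → β → ℤ := fun j b =>
    if b = j.1 then (if j.2.1 then -(m : ℤ) else m) else 0
  have hgad : ∀ (j : β × Bool × Fin K) (E : Finset α), #E ≤ D * (2 * K) * (A * s) →
      ∃ P Q : Finset α, Disjoint P Q ∧ Disjoint E (P ∪ Q) ∧ #(P ∪ Q) ≤ A * s ∧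
        ∀ b, ∑ c ∈ Q, φ c b - ∑ c ∈ P, φ c b = τ j b := by
    rintro ⟨b, ε, i⟩ E hE
    have hγφ : ∀ b', ∑ a, γ b a * φ a b' = if b' = b then (m : ℤ) else 0 := by
      intro b'
      split_ifs with h
      · rw [h, hγm]
      · exact hγ b b' h
    have hEW : #E + A * s ≤ W := by
      rw [add_mul, one_mul] at hW
      omega
    obtain ⟨P, Q, hd, hdE, hc, hs⟩ := exists_simulation_combination φ s W hsim A (γ b) E (hγA b) hEW
    cases ε with
    | false => exact ⟨P, Q, hd, hdE, hc, fun b' => by rw [hs, hγφ]; simp [τ]⟩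
    | true =>
      refine ⟨Q, P, hd.symm, by rwa [Finset.union_comm], by rwa [Finset.union_comm], fun b' => ?_⟩
      have h2 := hs b'
      rw [hγφ] at h2
      simp only [τ, if_true]
      split_ifs with h
      · rw [if_pos h] at h2; linarith
      · rw [if_neg h] at h2; linarith
  obtain ⟨P, Q, hPQ, hpair⟩ := exists_pairwise_disjoint_pairs
    (fun j P Q => ∀ b, ∑ c ∈ Q, φ c b - ∑ c ∈ P, φ c b = τ j b) (A * s)
    (D * (2 * K) * (A * s)) hgad univ (by simp [hD])
  have hpair' : ∀ i j, i ≠ j → Disjoint (P i ∪ Q i) (P j ∪ Q j) := fun i j hij =>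
    hpair i (Finset.mem_univ _) j (Finset.mem_univ _) hij
  have hPP : ∀ i j, i ≠ j → Disjoint (P i) (P j) := fun i j hij =>
    Finset.disjoint_of_subset_left Finset.subset_union_left
      (Finset.disjoint_of_subset_right Finset.subset_union_left (hpair' i j hij))
  have hQQ : ∀ i j, i ≠ j → Disjoint (Q i) (Q j) := fun i j hij =>
    Finset.disjoint_of_subset_left Finset.subset_union_right
      (Finset.disjoint_of_subset_right Finset.subset_union_right (hpair' i j hij))
  have hPQall : ∀ i j, Disjoint (P i) (Q j) := by
    intro i j
    by_cases hij : i = j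
    · subst hij; exact (hPQ i (Finset.mem_univ _)).1
    · exact Finset.disjoint_of_subset_left Finset.subset_union_left
        (Finset.disjoint_of_subset_right Finset.subset_union_right (hpair' i j hij))
  have hτ : ∀ j b, ∑ c ∈ Q j, φ c b - ∑ c ∈ P j, φ c b = τ j b := fun j =>
    (hPQ j (Finset.mem_univ _)).2.2
  let PP := univ.biUnion P
  let QQ := univ.biUnion Q
  have hPPQQ : Disjoint PP QQ := by
    simp only [PP, QQ, Finset.disjoint_biUnion_left, Finset.disjoint_biUnion_right]
    exact fun i _ j _ => hPQall j i
  have hcardPQ : #(PP ∪ QQ) ≤ W := by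
    have h2 : PP ∪ QQ = univ.biUnion fun j => P j ∪ Q j := by
      ext c
      simp only [PP, QQ, Finset.mem_union, Finset.mem_biUnion, Finset.mem_univ, true_and]
      exact exists_or.symm
    rw [h2]
    refine (Finset.card_biUnion_le_card_mul _ _ (A * s) fun j hj => (hPQ j hj).2.1).trans ?_
    refine le_trans ?_ hW
    refine Nat.mul_le_mul_right _ ?_
    simp [hD]
  -- the rounded fractional selection
  have hLamα : Lam ≤ Fintype.card α := by
    obtain ⟨b⟩ := ‹Nonempty β›
    have : (Lam : ℤ) ≤ Fintype.card α := by
      rw [← hLam b]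
      calc ∑ a, φ a b ≤ ∑ a : α, 1 := Finset.sum_le_sum fun a _ => h1 a b
        _ = _ := by simp
    exact_mod_cast this
  have hLampos : 0 < Lam := by
    by_contra! hL
    have hL0 : Lam = 0 := by omega
    obtain ⟨b⟩ := ‹Nonempty β›
    have hφ0 : ∀ a, φ a b = 0 := by
      have := hLam b
      rw [hL0, Nat.cast_zero, Finset.sum_eq_zero_iff_of_nonneg (fun a _ => h0 a b)] at this
      exact fun a => this a (Finset.mem_univ a)
    have := hγm b
    simp only [hφ0, mul_zero, Finset.sum_const_zero] at this
    omega
  have hLamR : (0 : ℝ) < Lam := by exact_mod_cast hLampos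
  obtain ⟨x, hx0, hx1, hxP, hxQ, hxφ⟩ := exists_fractional_selection φ W B hsim' PP QQ hPPQQ hcardPQ
    (lam / Lam) (by
      rw [← mul_div_assoc, div_le_one hLamR]
      exact_mod_cast hLam2) (by
      rw [div_mul_eq_mul_div, le_div_iff₀ hLamR, mul_comm]
      exact_mod_cast hB)
  have hxlam : ∀ b, ∑ a, x a * φ a b = lam := by
    intro b
    rw [hxφ]
    have : ∑ a, (φ a b : ℝ) = Lam := by exact_mod_cast hLam b
    rw [this, div_mul_cancel₀ _ hLamR.ne']
  obtain ⟨Y, hY1, hY0, hYφ⟩ := exists_rounding (fun a b => (φ a b : ℝ))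
    (fun a b => by exact_mod_cast h0 a b) (fun a b => by exact_mod_cast h1 a b) x hx0 hx1
  have hYlo : ∀ b, (lam : ℤ) ≤ ∑ a ∈ Y, φ a b := by
    intro b
    have := (hYφ b).1
    rw [hxlam] at this
    exact_mod_cast this
  have hYhi : ∀ b, ∑ a ∈ Y, φ a b ≤ lam + D := by
    intro b
    have := (hYφ b).2
    rw [hxlam] at this
    exact_mod_cast this
  have hPY : ∀ j, P j ⊆ Y := fun j c hc =>
    hY1 c (hxP c (Finset.mem_biUnion.2 ⟨j, Finset.mem_univ _, hc⟩))
  have hQY : ∀ j, Disjoint (Q j) Y := fun j => Finset.disjoint_left.2 fun c hc =>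
    hY0 c (hxQ c (Finset.mem_biUnion.2 ⟨j, Finset.mem_univ _, hc⟩))
  -- correction modulo `m`
  obtain ⟨S, hSY, hScard, hSm⟩ := exists_small_subset_sum_modEq m hm hDpos φ Y
  have hu : ∀ b, ∃ u : ℤ, ∑ a ∈ Y \ S, φ a b = lam + m * u := by
    intro b
    have h2 : ∑ a ∈ Y \ S, φ a b = ∑ a ∈ Y, φ a b - ∑ a ∈ S, φ a b := by
      rw [← Finset.sum_sdiff hSY]; ring
    obtain ⟨u, hu⟩ : (m : ℤ) ∣ ∑ a ∈ Y \ S, φ a b - lam := by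
      rw [h2]
      exact dvd_sub (hSm b) (by exact_mod_cast hmlam)
    exact ⟨u, by linarith⟩
  choose u hu using hu
  have hubound : ∀ b, (u b).natAbs + #S ≤ K := by
    intro b
    have h2 : ∑ a ∈ Y \ S, φ a b = ∑ a ∈ Y, φ a b - ∑ a ∈ S, φ a b := by
      rw [← Finset.sum_sdiff hSY]; ring
    have hS0 : 0 ≤ ∑ a ∈ S, φ a b := Finset.sum_nonneg fun a _ => h0 a b
    have hS1 : ∑ a ∈ S, φ a b ≤ #S := by
      calc ∑ a ∈ S, φ a b ≤ ∑ a ∈ S, 1 := Finset.sum_le_sum fun a _ => h1 a b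
        _ = _ := by simp
    have h3 : |(m : ℤ) * u b| ≤ D + m ^ 2 * D := by
      have h4 := hu b
      have h5 := hYlo b
      have h6 := hYhi b
      have h7 : (#S : ℤ) ≤ m ^ 2 * D := by exact_mod_cast hScard
      have h8 : (0 : ℤ) ≤ m ^ 2 * D := by positivity
      rw [abs_le]
      constructor <;> linarith
    have h9 : |u b| ≤ D + m ^ 2 * D := by
      refine le_trans ?_ h3
      rw [abs_mul, Nat.abs_cast]
      have : (1 : ℤ) ≤ m := by exact_mod_cast hm
      nlinarith [abs_nonneg (u b)]
    rw [Int.abs_eq_natAbs] at h9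
    have h10 : (u b).natAbs ≤ D + m ^ 2 * D := by exact_mod_cast h9
    have hScard' : #S ≤ m ^ 2 * D := hScard
    omega
  -- choice of the gadgets to switch
  let ε : β → Bool := fun b => decide (0 < u b)
  have hT : ∀ b, ∃ T : Finset (Fin K), #T = (u b).natAbs ∧
      ∀ i ∈ T, Disjoint (P (b, ε b, i)) S := by
    intro b
    let H : Finset (Fin K) := {i | ¬ Disjoint (P (b, ε b, i)) S}
    have hH : #H ≤ #S := by
      calc #H = ∑ i ∈ H, 1 := by simp
        _ ≤ ∑ i ∈ H, #(P (b, ε b, i) ∩ S) := by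
          refine Finset.sum_le_sum fun i hi => ?_
          rw [Nat.one_le_iff_ne_zero, ne_eq, Finset.card_eq_zero,
            ← Finset.disjoint_iff_inter_eq_empty]
          simpa [H] using hi
        _ = #(H.biUnion fun i => P (b, ε b, i) ∩ S) := by
          rw [Finset.card_biUnion]
          intro i _ j _ hij
          exact Finset.disjoint_of_subset_left Finset.inter_subset_left
            (Finset.disjoint_of_subset_right Finset.inter_subset_left
              (hPP _ _ (by simpa using hij)))
        _ ≤ #S := Finset.card_le_card (Finset.biUnion_subset.2 fun i _ => Finset.inter_subset_right)
    have h2 : (u b).natAbs ≤ #(univ \ H) := by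
      have h3 := Finset.card_sdiff_add_card_eq_card (Finset.subset_univ H)
      have h4 := hubound b
      rw [Finset.card_univ, Fintype.card_fin] at h3
      omega
    obtain ⟨T, hTH, hTc⟩ := Finset.exists_subset_card_eq h2
    refine ⟨T, hTc, fun i hi => ?_⟩
    have := hTH hi
    simpa [H] using this
  choose T hTcard hTS using hT
  let J : Finset (Σ _ : β, Fin K) := univ.sigma T
  let idx : (Σ _ : β, Fin K) → β × Bool × Fin K := fun z => (z.1, ε z.1, z.2)
  have hidx : ∀ z z', z ≠ z' → idx z ≠ idx z' := by
    rintro ⟨b, i⟩ ⟨b', i'⟩ hne heq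
    simp only [idx, Prod.mk.injEq] at heq
    obtain ⟨rfl, -, rfl⟩ := heq
    exact hne rfl
  let PJ := J.biUnion fun z => P (idx z)
  let QJ := J.biUnion fun z => Q (idx z)
  have hPJ : PJ ⊆ Y \ S := by
    refine Finset.biUnion_subset.2 fun z hz => Finset.subset_sdiff.2 ⟨hPY _, ?_⟩
    exact hTS z.1 z.2 (Finset.mem_sigma.1 hz).2
  have hQJ : Disjoint ((Y \ S) \ PJ) QJ := by
    refine (Finset.disjoint_biUnion_right _ _ _).2 fun z _ => ?_
    exact Finset.disjoint_of_subset_left (Finset.sdiff_subset.trans Finset.sdiff_subset)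
      (hQY _).symm
  refine ⟨((Y \ S) \ PJ) ∪ QJ, fun b => ?_⟩
  have hsumP : ∑ a ∈ PJ, φ a b = ∑ z ∈ J, ∑ a ∈ P (idx z), φ a b :=
    Finset.sum_biUnion fun z _ z' _ hne => hPP _ _ (hidx z z' hne)
  have hsumQ : ∑ a ∈ QJ, φ a b = ∑ z ∈ J, ∑ a ∈ Q (idx z), φ a b :=
    Finset.sum_biUnion fun z _ z' _ hne => hQQ _ _ (hidx z z' hne)
  have hdiff : ∑ a ∈ QJ, φ a b - ∑ a ∈ PJ, φ a b = -(m * u b) := by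
    rw [hsumP, hsumQ, ← Finset.sum_sub_distrib, Finset.sum_congr rfl fun z _ => hτ (idx z) b,
      Finset.sum_sigma, Finset.sum_eq_single b]
    · simp only [τ, idx, if_true, Finset.sum_const, hTcard, nsmul_eq_mul, ε, decide_eq_true_eq]
      split_ifs with h
      · rw [Int.natAbs_of_nonneg h.le]; ring
      · rw [Int.ofNat_natAbs_of_nonpos (not_lt.1 h)]; ring
    · intro b' _ hne
      refine Finset.sum_eq_zero fun i _ => ?_
      simp [τ, idx, hne.symm]
    · intro h
      exact absurd (Finset.mem_univ b) h
  rw [Finset.sum_union hQJ]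
  have h2 := Finset.sum_sdiff (f := fun a => φ a b) hPJ
  have h3 := hu b
  linarith

end Absorption

section Selection

open Finset

/-- A large transitive family of incidence vectors with locally decodable coordinates contains
a small subfamily covering every coordinate equally often. -/
theorem exists_balanced_selection {G α β ι : Type*} [Group G] [Fintype G] [MulAction G α]
    [MulAction G β] [Fintype α] [DecidableEq α] [Fintype β] [Nonempty β] [Fintype ι]
    [DecidableEq ι] [MulAction.IsPretransitive G α] (φ : α → β → ℤ)
    (hφ : ∀ (g : G) a b, φ (g • a) (g • b) = φ a b)
    (h0 : ∀ a b, 0 ≤ φ a b) (h1 : ∀ a b, φ a b ≤ 1) (hpos : ∀ a, ∃ b, 1 ≤ φ a b)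
    (δ : α → α → ι) (hinv : ∀ (g : G) a b, δ (g • a) (g • b) = δ a b)
    (hsymm : ∀ a b, δ a b = δ b a)
    (horb : ∀ a b a' b', δ a b = δ a' b' → ∃ g : G, g • a = a' ∧ g • b = b')
    (A m Lam : ℕ) (hm : 0 < m) (hA : 2 ≤ A) (hmA : m ≤ A) (hβA : Fintype.card β ≤ A)
    (hιA : Fintype.card ι ≤ A) (hLam : ∀ b, ∑ a, φ a b = Lam)
    (γ : β → α → ℤ) (hγA : ∀ b, ∑ a, (γ b a).natAbs ≤ A)
    (hγ : ∀ b b', b' ≠ b → ∑ a, γ b a * φ a b' = 0) (hγm : ∀ b, ∑ a, γ b a * φ a b = m)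
    (hcard : A ^ 30 ≤ Fintype.card α) :
    ∃ (lam : ℕ) (X : Finset α), 0 < lam ∧ #X ≤ A ^ 29 ∧ ∀ b, ∑ a ∈ X, φ a b = lam := by
  have hcount : ∀ X : Finset α, ∀ l : ℕ, (∀ b, ∑ a ∈ X, φ a b = l) →
      #X ≤ l * Fintype.card β := by
    intro X l hX
    have h2 : (#X : ℤ) ≤ l * Fintype.card β := by
      calc (#X : ℤ) = ∑ a ∈ X, 1 := by simp
        _ ≤ ∑ a ∈ X, ∑ b, φ a b := Finset.sum_le_sum fun a _ => by
            obtain ⟨b, hb⟩ := hpos a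
            exact hb.trans (Finset.single_le_sum (f := φ a) (fun b _ => h0 a b)
              (Finset.mem_univ b))
        _ = ∑ b, ∑ a ∈ X, φ a b := Finset.sum_comm
        _ = l * Fintype.card β := by simp [hX, mul_comm]
    exact_mod_cast h2
  have hpow : ∀ i j, i + 1 = j → 2 * A ^ i ≤ A ^ j := by
    rintro i _ rfl
    rw [pow_succ']
    exact Nat.mul_le_mul_right _ hA
  have hmono : ∀ {i j}, i ≤ j → A ^ i ≤ A ^ j := fun h => Nat.pow_le_pow_right (by omega) h
  have hApos : 0 < A := by omega
  have hs : A ^ 5 * (Fintype.card ι + 1) < A ^ 7 := by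
    rw [show A ^ 7 = A ^ 5 * (A * A) by ring]
    refine Nat.mul_lt_mul_of_pos_left ?_ (by positivity)
    nlinarith
  have hpig : (A ^ 5 + 1) ^ Fintype.card β < 2 ^ A ^ 5 := by
    have h2 : A ^ 5 + 1 ≤ A ^ 6 := by
      have := hpow 5 6 rfl
      have : 0 < A ^ 5 := by positivity
      omega
    calc (A ^ 5 + 1) ^ Fintype.card β ≤ (A ^ 6) ^ A :=
          (Nat.pow_le_pow_left h2 _).trans (Nat.pow_le_pow_right (by positivity) hβA)
      _ = A ^ (6 * A) := by rw [pow_mul]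
      _ < (2 ^ A) ^ (6 * A) := Nat.pow_lt_pow_left A.lt_two_pow_self (by omega)
      _ = 2 ^ (6 * A ^ 2) := by rw [← pow_mul]; ring_nf
      _ ≤ 2 ^ A ^ 5 := by
        refine Nat.pow_le_pow_right (by norm_num) ?_
        have := hpow 2 3 rfl
        have := hpow 3 4 rfl
        have := hpow 4 5 rfl
        omega
  have hsim := exists_simulation (G := G) φ hφ h0 h1 δ hinv hsymm horb (A ^ 7) (A ^ 5) (A ^ 14)
    ((hmono (by norm_num)).trans hcard) hs hpig (by
      refine le_trans ?_ ((hmono (show 27 ≤ 30 by norm_num)).trans hcard)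
      rw [← pow_add, ← pow_add]
      exact hpow 26 27 rfl)
  have hW : (Fintype.card β * (2 * (Fintype.card β + 2 * (m ^ 2 * Fintype.card β))) + 1) *
      (A * A ^ 5) ≤ A ^ 14 := by
    calc _ ≤ (A * (2 * (A + 2 * (A ^ 2 * A))) + 1) * (A * A ^ 5) := by gcongr
      _ ≤ A ^ 8 * (A * A ^ 5) := by
        refine Nat.mul_le_mul_right _ ?_
        have e : A * (2 * (A + 2 * (A ^ 2 * A))) + 1 = 2 * A ^ 2 + 4 * A ^ 4 + 1 := by ring
        have := hpow 2 3 rfl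
        have := hpow 3 4 rfl
        have := hpow 4 5 rfl
        have := hpow 5 6 rfl
        have := hpow 6 7 rfl
        have := hpow 7 8 rfl
        have : 0 < A ^ 2 := by positivity
        omega
      _ = A ^ 14 := by ring
  have hLamα : Lam ≤ Fintype.card α := by
    obtain ⟨b⟩ := ‹Nonempty β›
    have : (Lam : ℤ) ≤ Fintype.card α := by
      rw [← hLam b]
      calc ∑ a, φ a b ≤ ∑ a : α, 1 := Finset.sum_le_sum fun a _ => h1 a b
        _ = _ := by simp
    exact_mod_cast this
  have hLam2 : 2 * (m * A ^ 27) ≤ Lam := by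
    have h2 : Fintype.card α ≤ Lam * A := by
      have := hcount univ Lam hLam
      rw [Finset.card_univ] at this
      exact this.trans (Nat.mul_le_mul_left _ hβA)
    have h3 : A ^ 29 * A ≤ Lam * A := (by rw [← pow_succ]; exact hcard.trans h2)
    have h4 : A ^ 29 ≤ Lam := Nat.le_of_mul_le_mul_right h3 hApos
    refine le_trans ?_ h4
    calc 2 * (m * A ^ 27) ≤ A * (A * A ^ 27) := by gcongr
      _ = A ^ 29 := by ring
  obtain ⟨X, hX⟩ := exists_exact_selection φ h0 h1 (A ^ 5) (A ^ 14) (A ^ 13) A m (m * A ^ 27) Lam hm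
    (fun a E hE => (hsim a E hE).1)
    (fun a E hE => by
      obtain ⟨f, hf0, hfφ, hfB⟩ := (hsim a E hE).2
      refine ⟨f, hf0, hfφ, fun c => (hfB c).trans ?_⟩
      have := hpow 12 13 rfl
      rw [show A ^ 12 = A ^ 5 * A ^ 7 by ring, ← mul_assoc] at this
      exact_mod_cast this)
    γ hγA hγ hγm hLam (Nat.dvd_mul_right _ _) hLam2 hW (by
      calc Lam * (A ^ 14 * A ^ 13) ≤ Fintype.card α * A ^ 27 := by
            rw [← pow_add]
            exact Nat.mul_le_mul_right _ hLamα
        _ = 1 * A ^ 27 * Fintype.card α := by ring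
        _ ≤ m * A ^ 27 * Fintype.card α := by gcongr; exact hm)
  refine ⟨m * A ^ 27, X, by positivity, ?_, hX⟩
  calc #X ≤ m * A ^ 27 * Fintype.card β := hcount X _ hX
    _ ≤ A * A ^ 27 * A := by gcongr
    _ = A ^ 29 := by ring

end Selection

section Decoding

open Finset

/-- The coefficients used to decode the coordinate of a `t`-set from `k`-sets. -/
def decodingCoeff (l t k j : ℕ) : ℤ :=
  (-1) ^ (t - j) * ((l / t.choose j * (k - 1 - j).choose (t - j) : ℕ) : ℤ)

lemma alternating_sum_choose_eq_zero (n x : ℕ) (hn : 0 < n) :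
    ∑ i ∈ range (n + 1), (n.choose i : ℤ) * ((-1) ^ (n - i) * ((x + n - i).choose (n - 1) : ℤ)) =
      0 := by
  obtain ⟨n, rfl⟩ : ∃ i, n = i + 1 := ⟨n - 1, by omega⟩
  have h1 : (fwdDiff 1)^[n + 1] (fun y ↦ y.choose n : ℕ → ℤ) x = 0 := by
    have h2 := fwdDiff_iter_choose 0 n
    rw [add_zero] at h2
    rw [Function.iterate_succ_apply', h2]
    simp [fwdDiff]
  rw [fwdDiff_iter_eq_sum_shift] at h1
  have h2 : ∑ i ∈ range (n + 1 + 1), ((n + 1).choose i : ℤ) *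
      ((-1) ^ i * ((x + i).choose n : ℤ)) = 0 := by
    rw [← mul_eq_zero_iff_left (pow_ne_zero (n + 1) (show (-1 : ℤ) ≠ 0 by norm_num)), ← h1,
      Finset.mul_sum]
    refine Finset.sum_congr rfl fun i hi => ?_
    have hi' : i ≤ n + 1 := by simpa [Nat.lt_succ_iff] using hi
    have h3 : (-1 : ℤ) ^ (n + 1) = (-1) ^ (n + 1 - i) * (-1) ^ i := by
      rw [← pow_add, Nat.sub_add_cancel hi']
    have h4 : (-1 : ℤ) ^ i * (-1) ^ i = 1 := by rw [← mul_pow]; simp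
    rw [h3]
    simp only [smul_eq_mul, mul_one]
    linear_combination ((n + 1).choose i : ℤ) * ((x + i).choose n : ℤ) * (-1) ^ (n + 1 - i) * h4
  rw [← h2, ← Finset.sum_flip]
  refine Finset.sum_congr rfl fun i hi => ?_
  have hi' : i ≤ n + 1 := by simpa [Nat.lt_succ_iff] using hi
  rw [Nat.choose_symm hi', Nat.sub_sub_self hi', show x + (n + 1) - (n + 1 - i) = x + i by omega]
  rfl

lemma decodingCoeff_mul_choose {l t k j : ℕ} (hl : t.choose j ∣ l) (hjt : j ≤ t) :
    decodingCoeff l t k j * (k - 1).choose j = (-1) ^ (t - j) * (l * (k - 1).choose t : ℕ) := by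
  have h1 := Nat.choose_mul (n := k - 1) hjt
  have h2 : l / t.choose j * (k - 1 - j).choose (t - j) * (k - 1).choose j =
      l * (k - 1).choose t := by
    obtain ⟨q, rfl⟩ := hl
    rw [Nat.mul_div_cancel_left _ (Nat.choose_pos hjt)]
    calc _ = q * ((k - 1).choose j * (k - 1 - j).choose (t - j)) := by ring
      _ = _ := by rw [← h1]; ring
  rw [decodingCoeff, mul_assoc, ← Nat.cast_mul, h2]

lemma choose_mul_choose_sub_comm (N i j : ℕ) :
    N.choose i * (N - i).choose j = N.choose j * (N - j).choose i := by
  have h1 := Nat.choose_mul (n := N) (Nat.le_add_right i j)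
  have h2 := Nat.choose_mul (n := N) (Nat.le_add_left j i)
  rw [Nat.add_sub_cancel_left] at h1
  rw [Nat.add_sub_cancel] at h2
  rw [← h1, ← h2, Nat.choose_symm_add]

lemma sum_decodingCoeff_eq_zero {l t k a n : ℕ} (hl : ∀ j ≤ t, t.choose j ∣ l) (htk : t < k)
    (hat : a + n = t) (hn : 0 < n) :
    ∑ i ∈ range (n + 1), (n.choose i : ℤ) *
      (decodingCoeff l t k (a + i) * (k - n).choose (a + i)) = 0 := by
  have hpos : ((k - 1).choose (n - 1) : ℤ) ≠ 0 := by
    have := Nat.choose_pos (show n - 1 ≤ k - 1 by omega)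
    positivity
  rw [← mul_eq_zero_iff_right hpos]
  have key := alternating_sum_choose_eq_zero n (k - 1 - t) hn
  rw [Finset.sum_mul]
  calc _ = ∑ i ∈ range (n + 1), ((l * (k - 1).choose t : ℕ) : ℤ) *
        ((n.choose i : ℤ) * ((-1) ^ (n - i) * ((k - 1 - t + n - i).choose (n - 1) : ℤ))) := by
        refine Finset.sum_congr rfl fun i hi => ?_
        have hi' : i ≤ n := by simpa [Nat.lt_succ_iff] using hi
        have h1 := decodingCoeff_mul_choose (k := k) (hl (a + i) (by omega)) (by omega)
        have h2 := choose_mul_choose_sub_comm (k - 1) (n - 1) (a + i)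
        rw [show k - 1 - (n - 1) = k - n by omega] at h2
        have h2 : ((k - 1).choose (n - 1) : ℤ) * (k - n).choose (a + i) =
          (k - 1).choose (a + i) * (k - 1 - (a + i)).choose (n - 1) := by exact_mod_cast h2
        rw [show k - 1 - t + n - i = k - 1 - (a + i) by omega, show n - i = t - (a + i) by omega]
        linear_combination (n.choose i : ℤ) * decodingCoeff l t k (a + i) * h2 +
          (n.choose i : ℤ) * ((k - 1 - (a + i)).choose (n - 1) : ℤ) * h1
    _ = 0 := by rw [← Finset.mul_sum, key, mul_zero]

variable {V : Type*} [DecidableEq V]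

lemma sum_powerset_of_subset_apply_card {A T : Finset V} (hA : A ⊆ T) (h : ℕ → ℤ) :
    ∑ X ∈ T.powerset with A ⊆ X, h #X =
      ∑ i ∈ range (#(T \ A) + 1), ((#(T \ A)).choose i : ℤ) * h (#A + i) := by
  have h1 := Finset.sum_powerset_apply_card (fun i => h (#A + i)) (x := T \ A)
  simp only [nsmul_eq_mul] at h1
  rw [← h1]
  symm
  refine Finset.sum_bij' (fun X _ => A ∪ X) (fun X _ => X \ A) ?_ ?_ ?_ ?_ ?_
  · intro X hX
    have hX := Finset.mem_powerset.1 hX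
    simpa using Finset.union_subset hA (hX.trans Finset.sdiff_subset)
  · intro X hX
    rw [Finset.mem_filter, Finset.mem_powerset] at hX
    exact Finset.mem_powerset.2 (Finset.sdiff_subset_sdiff hX.1 subset_rfl)
  · intro X hX
    have hX := Finset.subset_sdiff.1 (Finset.mem_powerset.1 hX)
    exact Finset.union_sdiff_cancel_left hX.2.symm
  · intro X hX
    rw [Finset.mem_filter] at hX
    exact Finset.union_sdiff_of_subset hX.2
  · intro X hX
    have hX := Finset.subset_sdiff.1 (Finset.mem_powerset.1 hX)
    rw [Finset.card_union_of_disjoint hX.2.symm]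

/-- The decoding identity: exchanging subsets of `T` and of `U`, with the decoding coefficients as
weights, isolates `T` among all `t`-sets. -/
lemma sum_decodingCoeff_exchange {l t k : ℕ} (hl : ∀ j ≤ t, t.choose j ∣ l) (htk : t < k)
    {T U Q : Finset V} (hT : #T = t) (hU : #U = k) (hTU : Disjoint T U) (hQ : #Q = t) :
    ∑ X ∈ T.powerset, ∑ Z ∈ U.powersetCard #X,
      decodingCoeff l t k #X * (if Q ⊆ X ∪ (U \ Z) then 1 else 0) =
        if Q = T then ((l * k.choose t : ℕ) : ℤ) else 0 := by
  by_cases hQTU : Q ⊆ T ∪ U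
  swap
  · rw [if_neg (by rintro rfl; exact hQTU subset_union_left)]
    refine Finset.sum_eq_zero fun X hX => Finset.sum_eq_zero fun Z _ => ?_
    rw [if_neg, mul_zero]
    exact fun h => hQTU (h.trans (Finset.union_subset_union (Finset.mem_powerset.1 hX)
      Finset.sdiff_subset))
  have hcardQ : #(Q ∩ T) + #(U ∩ Q) = t := by
    rw [← hQ, ← Finset.card_union_of_disjoint]
    · congr 1
      ext x
      have := @hQTU x
      simp only [Finset.mem_union, Finset.mem_inter] at this ⊢
      tauto
    · exact Finset.disjoint_of_subset_left Finset.inter_subset_right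
        (Finset.disjoint_of_subset_right Finset.inter_subset_left hTU)
  set n := #(U ∩ Q) with hn
  have hUQ : #(U \ Q) = k - n := by
    have := Finset.card_sdiff_add_card_inter U Q
    omega
  have hTQ : #(T \ (Q ∩ T)) = n := by
    have h1 : T \ (Q ∩ T) = T \ Q := by ext; simp
    have h2 := Finset.card_sdiff_add_card_inter T Q
    rw [Finset.inter_comm] at h2
    rw [h1]
    omega
  have hinner : ∀ X ∈ T.powerset, ∑ Z ∈ U.powersetCard #X,
      decodingCoeff l t k #X * (if Q ⊆ X ∪ (U \ Z) then 1 else 0) =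
        if Q ∩ T ⊆ X then decodingCoeff l t k #X * (k - n).choose #X else 0 := by
    intro X hX
    have hX := Finset.mem_powerset.1 hX
    rw [← Finset.mul_sum, Finset.sum_boole]
    split_ifs with h
    · congr 2
      rw [← hUQ, ← Finset.card_powersetCard]
      congr 1
      ext Z
      simp only [Finset.mem_filter, Finset.mem_powersetCard, Finset.subset_sdiff]
      constructor
      · rintro ⟨⟨h1, h2⟩, h3⟩
        refine ⟨⟨h1, Finset.disjoint_left.2 fun x hxZ hxQ => ?_⟩, h2⟩
        rcases Finset.mem_union.1 (h3 hxQ) with h4 | h4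
        · exact Finset.disjoint_left.1 hTU (hX h4) (h1 hxZ)
        · exact (Finset.mem_sdiff.1 h4).2 hxZ
      · rintro ⟨⟨h1, h2⟩, h3⟩
        refine ⟨⟨h1, h3⟩, fun x hx => ?_⟩
        rcases Finset.mem_union.1 (hQTU hx) with h4 | h4
        · exact Finset.mem_union_left _ (h (Finset.mem_inter.2 ⟨hx, h4⟩))
        · exact Finset.mem_union_right _ (Finset.mem_sdiff.2
            ⟨h4, fun h5 => Finset.disjoint_left.1 h2 h5 hx⟩)
    · rw [Finset.filter_eq_empty_iff.2, Finset.card_empty, Nat.cast_zero, mul_zero]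
      intro Z _ h1
      refine h fun x hx => ?_
      obtain ⟨hxQ, hxT⟩ := Finset.mem_inter.1 hx
      rcases Finset.mem_union.1 (h1 hxQ) with h4 | h4
      · exact h4
      · exact absurd (Finset.mem_sdiff.1 h4).1 (Finset.disjoint_left.1 hTU hxT)
  rw [Finset.sum_congr rfl hinner, ← Finset.sum_filter,
    sum_powerset_of_subset_apply_card Finset.inter_subset_right
      (fun j => decodingCoeff l t k j * (k - n).choose j), hTQ]
  rcases Nat.eq_zero_or_pos n with h | h
  · have hQT : Q = T := by
      have h1 : #(Q ∩ T) = t := by omega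
      have h2 : Q ∩ T = Q := Finset.eq_of_subset_of_card_le Finset.inter_subset_left (by omega)
      exact Finset.eq_of_subset_of_card_le (Finset.inter_eq_left.1 h2) (by omega)
    rw [if_pos hQT, h, show #(Q ∩ T) = t by omega]
    simp [decodingCoeff]
  · have hQT : Q ≠ T := by
      rintro rfl
      rw [hn, Finset.inter_comm, Finset.disjoint_iff_inter_eq_empty.1 hTU] at h
      simp at h
    rw [if_neg hQT]
    exact sum_decodingCoeff_eq_zero hl htk hcardQ h

lemma choose_le_add_choose_add (n k i : ℕ) : n.choose k ≤ (n + i).choose (k + i) := by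
  induction i with
  | zero => rfl
  | succ i ih =>
    rw [← add_assoc, ← add_assoc, Nat.choose_succ_succ]
    omega

omit [DecidableEq V] in
lemma sum_natAbs_decodingCoeff_le {l t k : ℕ} (htk : t < k) {T U : Finset V} (hT : #T = t)
    (hU : #U = k) :
    ∑ X ∈ T.powerset, ∑ _Z ∈ U.powersetCard #X, (decodingCoeff l t k #X).natAbs ≤
      (k + t).choose t * (l * k.choose t) := by
  have h1 : ∀ j ≤ t, (decodingCoeff l t k j).natAbs ≤ l * k.choose t := by
    intro j hj
    rw [decodingCoeff, Int.natAbs_mul, Int.natAbs_pow, Int.natAbs_neg, Int.natAbs_one, one_pow,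
      one_mul, Int.natAbs_natCast]
    refine Nat.mul_le_mul (Nat.div_le_self _ _) ?_
    calc (k - 1 - j).choose (t - j) ≤ (k - 1 - j + j).choose (t - j + j) :=
          choose_le_add_choose_add ..
      _ ≤ k.choose t := by
        rw [Nat.sub_add_cancel hj]
        exact Nat.choose_le_choose t (by omega)
  have h3 := Finset.sum_powerset_apply_card (fun j => k.choose j) (x := T)
  simp only [smul_eq_mul, hT] at h3
  have h4 := Nat.add_choose_eq k t t
  rw [Finset.Nat.sum_antidiagonal_eq_sum_range_succ (fun i j => k.choose i * t.choose j)] at h4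
  have h5 : (k + t).choose t = ∑ X ∈ T.powerset, k.choose #X := by
    rw [h3, h4]
    refine Finset.sum_congr rfl fun i hi => ?_
    rw [Nat.choose_symm (by simpa [Nat.lt_succ_iff] using hi), mul_comm]
  rw [h5, Finset.sum_mul]
  refine Finset.sum_le_sum fun X hX => ?_
  rw [Finset.sum_const, Finset.card_powersetCard, hU, smul_eq_mul]
  exact Nat.mul_le_mul_left _ (h1 _ (hT ▸ Finset.card_le_card (Finset.mem_powerset.1 hX)))

end Decoding

section Concrete

open Finset

open scoped Pointwise

/-- Permutations act transitively on pairs of `k`-sets with given size of the intersection. -/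
lemma exists_perm_smul_eq_of_card_inter_eq {V : Type*} [Fintype V] [DecidableEq V]
    {a b a' b' : Finset V} (ha : #a = #a') (hb : #b = #b') (hab : #(a ∩ b) = #(a' ∩ b')) :
    ∃ g : Equiv.Perm V, g • a = a' ∧ g • b = b' := by
  let f : V → Bool × Bool := fun x => (decide (x ∈ a), decide (x ∈ b))
  let f' : V → Bool × Bool := fun x => (decide (x ∈ a'), decide (x ∈ b'))
  have hcard : ∀ c, Fintype.card {x // f x = c} = Fintype.card {x // f' x = c} := by
    have h1 := Finset.card_sdiff_add_card_inter a b
    have h1' := Finset.card_sdiff_add_card_inter a' b'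
    have h2 := Finset.card_sdiff_add_card_inter b a
    have h2' := Finset.card_sdiff_add_card_inter b' a'
    rw [Finset.inter_comm b] at h2
    rw [Finset.inter_comm b'] at h2'
    have h3 := Finset.card_union_add_card_inter a b
    have h3' := Finset.card_union_add_card_inter a' b'
    have h4 := Finset.card_compl_add_card (a ∪ b)
    have h4' := Finset.card_compl_add_card (a' ∪ b')
    rintro ⟨p, q⟩
    rw [Fintype.card_subtype, Fintype.card_subtype]
    cases p <;> cases q
    · have e : ∀ x y : Finset V, ({z | (decide (z ∈ x), decide (z ∈ y)) = (false, false)} :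
          Finset V) = (x ∪ y)ᶜ := fun x y => by ext; simp
      simp only [f, f', e]; omega
    · have e : ∀ x y : Finset V, ({z | (decide (z ∈ x), decide (z ∈ y)) = (false, true)} :
          Finset V) = y \ x := fun x y => by ext; simp [and_comm]
      simp only [f, f', e]; omega
    · have e : ∀ x y : Finset V, ({z | (decide (z ∈ x), decide (z ∈ y)) = (true, false)} :
          Finset V) = x \ y := fun x y => by ext; simp
      simp only [f, f', e]; omega
    · have e : ∀ x y : Finset V, ({z | (decide (z ∈ x), decide (z ∈ y)) = (true, true)} :
          Finset V) = x ∩ y := fun x y => by ext; simp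
      simp only [f, f', e]; omega
  let g : Equiv.Perm V := Equiv.ofFiberEquiv fun c => Fintype.equivOfCardEq (hcard c)
  have hg : ∀ x, f' (g x) = f x := fun x => Equiv.ofFiberEquiv_map _ x
  simp only [f, f', Prod.mk.injEq, decide_eq_decide] at hg
  refine ⟨g, ?_, ?_⟩
  · ext x
    rw [← Finset.inv_smul_mem_iff, ← (hg _).1]
    simp [Equiv.Perm.smul_def]
  · ext x
    rw [← Finset.inv_smul_mem_iff, ← (hg _).2]
    simp [Equiv.Perm.smul_def]

lemma le_choose_self {n t : ℕ} (ht : 1 ≤ t) (htn : t < n) : n ≤ n.choose t := by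
  induction n with
  | zero => omega
  | succ n ih =>
    obtain ⟨s, rfl⟩ : ∃ s, t = s + 1 := ⟨t - 1, by omega⟩
    rw [Nat.choose_succ_succ']
    rcases Nat.lt_or_ge (s + 1) n with h | h
    · have := ih h
      have := Nat.choose_pos (show s ≤ n by omega)
      omega
    · obtain rfl : n = s + 1 := by omega
      simp

/-- Designs of bounded size exist as soon as there are sufficiently many blocks. -/
lemma exists_isDesign_of_le_choose {v t k : ℕ} (ht : 1 ≤ t) (htk : t < k) (hkv : k + t ≤ v)
    (hcard : (t.lcmUpto * v.choose t ^ 2) ^ 30 ≤ v.choose k) :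
    ∃ lam : ℕ, 0 < lam ∧ ∃ T : Finset (Finset (Fin v)), IsDesign v k t lam T ∧
      #T ≤ (t.lcmUpto * v.choose t ^ 2) ^ 29 := by
  classical
  set l := t.lcmUpto with hl
  set D := v.choose t with hD
  have hlpos : 0 < l := Nat.lcmUpto_pos t
  have hvD : v ≤ D := le_choose_self ht (by omega)
  have hcardk : Fintype.card (Set.powersetCard (Fin v) k) = v.choose k := by
    rw [← Nat.card_eq_fintype_card, Set.powersetCard.card, Nat.card_eq_fintype_card,
      Fintype.card_fin]
  have hcardt : Fintype.card (Set.powersetCard (Fin v) t) = D := by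
    rw [← Nat.card_eq_fintype_card, Set.powersetCard.card, Nat.card_eq_fintype_card,
      Fintype.card_fin]
  have hkD : k.choose t ≤ D := Nat.choose_le_choose t (by omega)
  have hktD : (k + t).choose t ≤ D := Nat.choose_le_choose t hkv
  have hDA : D ≤ l * D ^ 2 := by
    calc D = 1 * D ^ 1 := by ring
      _ ≤ l * D ^ 2 := Nat.mul_le_mul hlpos (Nat.pow_le_pow_right (by omega) (by norm_num))
  have : MulAction.IsPretransitive (Equiv.Perm (Fin v)) (Set.powersetCard (Fin v) k) :=
    Set.powersetCard.isPretransitive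
  have htrans : MulAction.IsPretransitive (Equiv.Perm (Fin v)) (Set.powersetCard (Fin v) t) :=
    Set.powersetCard.isPretransitive
  have : Nonempty (Set.powersetCard (Fin v) t) := Fintype.card_pos_iff.1 (by omega)
  let φ : Set.powersetCard (Fin v) k → Set.powersetCard (Fin v) t → ℤ :=
    fun a b => if (b : Finset (Fin v)) ⊆ a then 1 else 0
  have hφ : ∀ (g : Equiv.Perm (Fin v)) a b, φ (g • a) (g • b) = φ a b := fun g a b => by
    simp [φ]
  let δ : Set.powersetCard (Fin v) k → Set.powersetCard (Fin v) k → Fin (k + 1) :=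
    fun a b => ⟨#((a : Finset (Fin v)) ∩ b), Nat.lt_succ_of_le
      ((Finset.card_le_card Finset.inter_subset_left).trans a.2.le)⟩
  obtain ⟨b₀⟩ := ‹Nonempty (Set.powersetCard (Fin v) t)›
  have hLam : ∀ b, ∑ a, φ a b =
      (#{a : Set.powersetCard (Fin v) k | (b₀ : Finset (Fin v)) ⊆ a} : ℕ) := by
    intro b
    obtain ⟨g, rfl⟩ := htrans.exists_smul_eq b₀ b
    rw [← Equiv.sum_comp (MulAction.toPerm g)]
    simp only [MulAction.toPerm_apply, hφ]
    simp [φ]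
  have hdec : ∀ T : Set.powersetCard (Fin v) t, ∃ γ : Set.powersetCard (Fin v) k → ℤ,
      ∑ a, (γ a).natAbs ≤ l * D ^ 2 ∧
      ∀ Q, ∑ a, γ a * φ a Q = if Q = T then ((l * k.choose t : ℕ) : ℤ) else 0 := by
    rintro ⟨T, hT⟩
    have hT : #T = t := hT
    obtain ⟨U, hUT, hU⟩ := Finset.exists_subset_card_eq (show k ≤ #Tᶜ by
      rw [Finset.card_compl, hT, Fintype.card_fin]; omega)
    have hTU : Disjoint T U := Finset.disjoint_of_subset_right hUT disjoint_compl_right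
    refine ⟨fun a => ∑ X ∈ T.powerset, ∑ Z ∈ U.powersetCard #X,
      if X ∪ (U \ Z) = a then decodingCoeff l t k #X else 0, ?_, fun Q => ?_⟩
    · calc _ ≤ ∑ a : Set.powersetCard (Fin v) k, ∑ X ∈ T.powerset, ∑ Z ∈ U.powersetCard #X,
            if X ∪ (U \ Z) = a then (decodingCoeff l t k #X).natAbs else 0 := by
            refine Finset.sum_le_sum fun a _ => (Int.natAbs_sum_le _ _).trans ?_
            refine Finset.sum_le_sum fun X _ => (Int.natAbs_sum_le _ _).trans ?_
            refine Finset.sum_le_sum fun Z _ => ?_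
            split_ifs <;> simp
        _ = ∑ X ∈ T.powerset, ∑ Z ∈ U.powersetCard #X, ∑ a : Set.powersetCard (Fin v) k,
            if X ∪ (U \ Z) = a then (decodingCoeff l t k #X).natAbs else 0 := by
            rw [Finset.sum_comm]
            exact Finset.sum_congr rfl fun X _ => Finset.sum_comm
        _ ≤ ∑ X ∈ T.powerset, ∑ _Z ∈ U.powersetCard #X, (decodingCoeff l t k #X).natAbs := by
            refine Finset.sum_le_sum fun X _ => Finset.sum_le_sum fun Z _ => ?_
            rw [← Finset.sum_filter, Finset.sum_const, smul_eq_mul]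
            refine mul_le_of_le_one_left (Nat.zero_le _) ?_
            rw [Finset.card_le_one]
            intro a ha b hb
            simp only [Finset.mem_filter, Finset.mem_univ, true_and] at ha hb
            exact Subtype.ext (ha.symm.trans hb)
        _ ≤ (k + t).choose t * (l * k.choose t) := sum_natAbs_decodingCoeff_le htk hT hU
        _ ≤ D * (l * D) := Nat.mul_le_mul hktD (Nat.mul_le_mul_left _ hkD)
        _ = l * D ^ 2 := by ring
    · have hl' : ∀ j ≤ t, t.choose j ∣ l := fun j hj => Chebyshev.choose_dvd_lcmUpto hj
      have h1 := sum_decodingCoeff_exchange hl' htk hT hU hTU Q.2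
      simp only [Subtype.ext_iff, ← h1]
      simp_rw [Finset.sum_mul]
      rw [Finset.sum_comm]
      refine Finset.sum_congr rfl fun X hX => ?_
      rw [Finset.sum_comm]
      refine Finset.sum_congr rfl fun Z hZ => ?_
      have hX := Finset.mem_powerset.1 hX
      obtain ⟨hZU, hZX⟩ := Finset.mem_powersetCard.1 hZ
      have hXZ : #(X ∪ (U \ Z)) = k := by
        rw [Finset.card_union_of_disjoint (Finset.disjoint_of_subset_left hX
          (Finset.disjoint_of_subset_right Finset.sdiff_subset hTU))]
        have := Finset.card_sdiff_add_card_eq_card hZU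
        omega
      rw [Finset.sum_eq_single ⟨X ∪ (U \ Z), hXZ⟩]
      · simp [φ]
      · intro a _ ha
        rw [if_neg, zero_mul]
        intro h
        exact ha (Subtype.ext h.symm)
      · exact fun h => absurd (Finset.mem_univ _) h
  choose γ hγA hγ using hdec
  obtain ⟨lam, X, hlam, hX, hXφ⟩ := exists_balanced_selection (G := Equiv.Perm (Fin v)) φ hφ
    (fun a b => by simp only [φ]; split_ifs <;> norm_num)
    (fun a b => by simp only [φ]; split_ifs <;> norm_num)
    (fun a => by
      obtain ⟨b, hb, hbt⟩ := Finset.exists_subset_card_eq (show t ≤ #(a : Finset (Fin v)) by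
        rw [a.2]; exact htk.le)
      exact ⟨⟨b, hbt⟩, by simp [φ, hb]⟩)
    δ (fun g a b => by
      simp only [δ, Set.powersetCard.coe_smul, ← Finset.smul_finset_inter, Finset.card_smul_finset])
    (fun a b => by simp only [δ, Finset.inter_comm])
    (fun a b a' b' h => by
      obtain ⟨g, hga, hgb⟩ := exists_perm_smul_eq_of_card_inter_eq (a.2.trans a'.2.symm)
        (b.2.trans b'.2.symm) (by simpa [δ] using h)
      exact ⟨g, Subtype.ext hga, Subtype.ext hgb⟩)
    (l * D ^ 2) (l * k.choose t) _ (Nat.mul_pos hlpos (Nat.choose_pos htk.le)) (by omega)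
    (Nat.mul_le_mul_left _ (hkD.trans (Nat.le_self_pow two_ne_zero _)))
    (by rw [hcardt]; exact hDA) (by rw [Fintype.card_fin]; omega) hLam γ hγA
    (fun b b' h => by rw [hγ, if_neg h]) (fun b => by rw [hγ, if_pos rfl]) (by rwa [hcardk])
  refine ⟨lam, hlam, X.image Subtype.val, ⟨?_, ?_⟩, Finset.card_image_le.trans hX⟩
  · intro b hb
    obtain ⟨a, _, rfl⟩ := Finset.mem_image.1 hb
    exact a.2
  · intro s hs
    have h1 := hXφ ⟨s, hs⟩
    simp only [φ, Finset.sum_boole] at h1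
    rw [Finset.filter_image, Finset.card_image_of_injective _ Subtype.val_injective]
    exact_mod_cast h1

end Concrete

section Bounds

open Finset

lemma isDesign_powersetCard {v k t : ℕ} (htk : t ≤ k) :
    IsDesign v k t ((v - t).choose (k - t)) (powersetCard k (univ : Finset (Fin v))) := by
  refine ⟨fun b hb => (mem_powersetCard.1 hb).2, fun s hs => ?_⟩
  rw [card_filter_powersetCard_subset _ _ _ (subset_univ s) (by omega), card_univ,
    Fintype.card_fin, hs]

lemma choose_le_exp_mul_div_pow {v t j : ℕ} (ht : 1 ≤ t) (htv : t ≤ v) (hj : j ≤ t) :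
    (v.choose j : ℝ) ≤ (Real.exp 1 * v / t) ^ t := by
  have ht0 : (0 : ℝ) < t := by exact_mod_cast ht
  have h1 : (1 : ℝ) ≤ v / t := by
    rw [one_le_div ht0]
    exact_mod_cast htv
  calc (v.choose j : ℝ) ≤ v ^ j / j.factorial := Nat.choose_le_pow_div j v
    _ = ((t : ℝ) ^ j / j.factorial) * (v / t : ℝ) ^ j := by
        rw [div_pow]
        field_simp
    _ ≤ Real.exp t * (v / t : ℝ) ^ t := by
        gcongr
        · exact Real.pow_div_factorial_le_exp _ ht0.le _
    _ = (Real.exp 1 * v / t) ^ t := by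
        rw [mul_div_assoc, mul_pow, ← Real.exp_nat_mul, mul_one]

lemma lcmUpto_le_exp (t : ℕ) : (t.lcmUpto : ℝ) ≤ Real.exp 1 ^ (6 * t) := by
  rw [← Real.exp_nat_mul, mul_one,
    ← Real.log_le_iff_le_exp (by exact_mod_cast Nat.lcmUpto_pos t), ← Chebyshev.psi_eq_log_lcmUpto]
  refine (Chebyshev.psi_le_const_mul_self (Nat.cast_nonneg t)).trans ?_
  push_cast
  gcongr
  linarith [Real.log_four_eq, Real.log_two_lt_d9]

lemma lcmUpto_mul_choose_sq_pow_le {v t n : ℕ} (ht : 1 ≤ t) (htv : t ≤ v) (hn : n ≤ 30) :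
    (((t.lcmUpto * v.choose t ^ 2) ^ n : ℕ) : ℝ) ≤ (Real.exp 1 * v / t) ^ (240 * t) := by
  have ht0 : (0 : ℝ) < t := by exact_mod_cast ht
  have hx : Real.exp 1 ≤ Real.exp 1 * v / t := by
    rw [mul_div_assoc]
    refine le_mul_of_one_le_right (Real.exp_pos _).le ?_
    rw [one_le_div ht0]
    exact_mod_cast htv
  have hx1 : 1 ≤ Real.exp 1 * v / t := (Real.one_le_exp zero_le_one).trans hx
  have hA : ((t.lcmUpto * v.choose t ^ 2 : ℕ) : ℝ) ≤ (Real.exp 1 * v / t) ^ (8 * t) := by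
    push_cast
    calc (t.lcmUpto : ℝ) * (v.choose t : ℝ) ^ 2
        ≤ (Real.exp 1 * v / t) ^ (6 * t) * ((Real.exp 1 * v / t) ^ t) ^ 2 := by
          gcongr
          · exact (lcmUpto_le_exp t).trans (by gcongr)
          · exact choose_le_exp_mul_div_pow ht htv le_rfl
      _ = (Real.exp 1 * v / t) ^ (8 * t) := by ring
  rw [Nat.cast_pow]
  calc _ ≤ ((Real.exp 1 * v / t) ^ (8 * t)) ^ n := by gcongr
    _ = (Real.exp 1 * v / t) ^ (8 * t * n) := (pow_mul _ _ _).symm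
    _ ≤ _ := pow_le_pow_right₀ hx1 (by nlinarith)

lemma exists_isDesign_card_le {v t k : ℕ} (ht : 1 ≤ t) (htk : t ≤ k) (hkv : k ≤ v) :
    ∃ lam : ℕ, 0 < lam ∧ ∃ T : Finset (Finset (Fin v)), IsDesign v k t lam T ∧
      (#T : ℝ) ≤ (Real.exp 1 * v / t) ^ (240 * t) := by
  have htv : t ≤ v := htk.trans hkv
  by_cases h : t < k ∧ k + t ≤ v ∧ (t.lcmUpto * v.choose t ^ 2) ^ 30 ≤ v.choose k
  · obtain ⟨lam, hlam, T, hT, hcard⟩ := exists_isDesign_of_le_choose ht h.1 h.2.1 h.2.2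
    exact ⟨lam, hlam, T, hT, (Nat.cast_le.2 hcard).trans
      (lcmUpto_mul_choose_sq_pow_le ht htv (by norm_num))⟩
  · refine ⟨_, Nat.choose_pos (by omega), _, isDesign_powersetCard htk, ?_⟩
    rw [card_powersetCard, card_univ, Fintype.card_fin]
    have ht0 : (0 : ℝ) < t := by exact_mod_cast ht
    have hx1 : 1 ≤ Real.exp 1 * v / t := by
      rw [mul_div_assoc]
      refine one_le_mul_of_one_le_of_one_le (Real.one_le_exp zero_le_one) ?_
      rw [one_le_div ht0]
      exact_mod_cast htv
    have hpow : (Real.exp 1 * v / t) ^ t ≤ (Real.exp 1 * v / t) ^ (240 * t) :=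
      pow_le_pow_right₀ hx1 (by omega)
    by_cases h1 : t < k
    · by_cases h2 : k + t ≤ v
      · have h3 : v.choose k ≤ (t.lcmUpto * v.choose t ^ 2) ^ 30 := by
          by_contra h3
          exact h ⟨h1, h2, by omega⟩
        exact (Nat.cast_le.2 h3).trans (lcmUpto_mul_choose_sq_pow_le ht htv le_rfl)
      · rw [← Nat.choose_symm hkv]
        exact (choose_le_exp_mul_div_pow ht htv (by omega)).trans hpow
    · exact (choose_le_exp_mul_div_pow ht htv (by omega)).trans hpow

end Bounds

/-- There exists a universal constant `c > 0` such that for all integers `v ≥ 1`,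
`1 ≤ t ≤ v` and `t ≤ k ≤ v` there exists a simple `t-(v,k,λ)` design (for some positive
integer `λ`) whose size is at most `(c·v/t)^(c·t)`. -/
theorem exists_design :
    ∃ c : ℝ, 0 < c ∧
      ∀ v t k : ℕ, 1 ≤ v → 1 ≤ t → t ≤ v → t ≤ k → k ≤ v →
        ∃ lam : ℕ, 0 < lam ∧
          ∃ T : Finset (Finset (Fin v)), IsDesign v k t lam T ∧
            (T.card : ℝ) ≤ (c * v / t) ^ (c * t) := by
  refine ⟨240, by norm_num, fun v t k _ ht _ htk hkv => ?_⟩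
  obtain ⟨lam, hlam, T, hT, hcard⟩ := exists_isDesign_card_le ht htk hkv
  refine ⟨lam, hlam, T, hT, hcard.trans ?_⟩
  have h : ((240 : ℝ) * t) = ((240 * t : ℕ) : ℝ) := by push_cast; ring
  rw [h, Real.rpow_natCast]
  gcongr
  linarith [Real.exp_one_lt_d9]
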